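/- arXiv:1912.08330 — 6 statements merged into one kernel-verified Lean document; each statement's English description precedes it below -/
import Mathlib

section
/- Let ABC be a nondegenerate triangle in ℂ with circumcircle Ω. Let P and P′ be distinct isogonal conjugates with respect to ABC with no three of A, B, C, P, P′ collinear. Let Q ≠ P lie on line PP′ with no three of A, B, C, P, Q collinear. Let D be a point lying on both Ω and the conic (ABCPP′) with D ∉ {A, B, C}, and let X ≠ D be the second intersection of line DP with Ω. Assume P, Q, X are not collinear. Then the circle through P, Q, X and the conic (ABCPQ) are tangent at P (they pass through P and have the same tangent line at P). -/
noncomputable section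

/-- The line through the points `u` and `v`. -/
def lineThrough (u v : ℂ) : Set ℂ := {z : ℂ | ∃ t : ℝ, z = u + t • (v - u)}

/-- A subset of `ℂ` is a line if it is the line through two distinct points. -/
def IsLine (L : Set ℂ) : Prop := ∃ u v : ℂ, u ≠ v ∧ L = lineThrough u v

/-- The circle with center `O` and radius `r`. -/
def circleSet (O : ℂ) (r : ℝ) : Set ℂ := {z : ℂ | ‖z - O‖ = r}

/-- The value at `z` of the real quadratic polynomial with coefficients `a, b, c, d, e, f`
in the coordinates `x = Re z`, `y = Im z`. -/
def conicEval (a b c d e f : ℝ) (z : ℂ) : ℝ :=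
  a * z.re ^ 2 + b * z.re * z.im + c * z.im ^ 2 + d * z.re + e * z.im + f

/-- The gradient at `z` of the real quadratic polynomial with coefficients
`a, b, c, d, e, f`, regarded as a complex number. -/
def conicGrad (a b c d e f : ℝ) (z : ℂ) : ℂ :=
  ((2 * a * z.re + b * z.im + d : ℝ) : ℂ) + ((b * z.re + 2 * c * z.im + e : ℝ) : ℂ) * Complex.I

/-- A conic: the zero set of a nonzero real polynomial of total degree at most 2 in the
coordinates `x = Re z`, `y = Im z`. -/
def IsConic (S : Set ℂ) : Prop :=
  ∃ a b c d e f : ℝ, ¬(a = 0 ∧ b = 0 ∧ c = 0 ∧ d = 0 ∧ e = 0 ∧ f = 0) ∧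
    S = {z : ℂ | conicEval a b c d e f z = 0}

/-- The line through `Z` perpendicular to the (nonzero) vector `g`. -/
def perpLineAt (Z g : ℂ) : Set ℂ :=
  {w : ℂ | (w - Z).re * g.re + (w - Z).im * g.im = 0}

/-- `L` is the tangent line of the conic `S` at the point `Z`: for some defining polynomial
`f` of `S` vanishing at `Z` with `∇f(Z) ≠ 0`, `L` is the line through `Z` perpendicular
to `∇f(Z)`. -/
def IsConicTangentLineAt (S : Set ℂ) (Z : ℂ) (L : Set ℂ) : Prop :=
  ∃ a b c d e f : ℝ, ¬(a = 0 ∧ b = 0 ∧ c = 0 ∧ d = 0 ∧ e = 0 ∧ f = 0) ∧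
    S = {z : ℂ | conicEval a b c d e f z = 0} ∧
    conicEval a b c d e f Z = 0 ∧ conicGrad a b c d e f Z ≠ 0 ∧
    L = perpLineAt Z (conicGrad a b c d e f Z)

/-- The circle with center `O` and radius `r` and the conic `S` are tangent at `Z`:
both pass through `Z` and the tangent line of the circle at `Z` (the line through `Z`
perpendicular to the radius) is the tangent line of the conic at `Z`. -/
def CircleConicTangentAt (O : ℂ) (r : ℝ) (S : Set ℂ) (Z : ℂ) : Prop :=
  Z ∈ circleSet O r ∧ Z ∈ S ∧ IsConicTangentLineAt S Z (perpLineAt Z (Z - O))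

/-- `P` and `P'` are isogonal conjugates with respect to the triangle `ABC`. -/
def IsogConj (A B C P P' : ℂ) : Prop :=
  ((P - A) * (P' - A) / ((B - A) * (C - A))).im = 0 ∧
  ((P - B) * (P' - B) / ((C - B) * (A - B))).im = 0 ∧
  ((P - C) * (P' - C) / ((A - C) * (B - C))).im = 0

/-- No three of the points in the list `l` are collinear. -/
def NoThreeCollinear (l : List ℂ) : Prop :=
  ∀ i j k : Fin l.length, i ≠ j → i ≠ k → j ≠ k →
    ¬ Collinear ℝ ({l.get i, l.get j, l.get k} : Set ℂ)

/-- Four points lie on a common circle. -/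
def Concyclic4 (A B C D : ℂ) : Prop :=
  ∃ O : ℂ, ∃ r : ℝ, 0 < r ∧ A ∈ circleSet O r ∧ B ∈ circleSet O r ∧
    C ∈ circleSet O r ∧ D ∈ circleSet O r

/-- Orthogonal reflection of `z` across the line through `u` with direction `v`. -/
def reflAcross (u v z : ℂ) : ℂ :=
  u + v / (starRingEnd ℂ) v * (starRingEnd ℂ) (z - u)

/-- `O'` is a center of `S`: the point reflection about `O'` maps `S` onto itself. -/
def IsCenter (S : Set ℂ) (O' : ℂ) : Prop :=
  (fun z => 2 * O' - z) '' S = S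

namespace IsogonalConic

open ComplexConjugate

section Algebra

variable {K : Type*} [Field K]

/-- Isogonal conjugates with respect to a triangle inscribed in the circle `w * wb = R`. -/
lemma isogonal_sum {R a b c p p' pb pb' : K} (hab : a ≠ b)
    (ha : (p - a) * (p' - a) * R ^ 2 = b * c * (a * pb - R) * (a * pb' - R))
    (hb : (p - b) * (p' - b) * R ^ 2 = c * a * (b * pb - R) * (b * pb' - R)) :
    R ^ 2 * (p + p') + a * b * c * (pb * pb') = R ^ 2 * (a + b + c) := by
  apply mul_left_cancel₀ (sub_ne_zero.mpr hab)
  linear_combination hb - ha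

/-- On the circle `w * wb = R` a conic is cut out by a quartic in `w`. -/
lemma quartic_of_conic {R w wb α αb β γ γb δ : K} (hw : w * wb = R)
    (h : α * w ^ 2 + αb * wb ^ 2 + β * (w * wb) + γ * w + γb * wb + δ = 0) :
    α * w ^ 4 + γ * w ^ 3 + (β * R + δ) * w ^ 2 + R * γb * w + R ^ 2 * αb = 0 := by
  subst hw
  linear_combination w ^ 2 * h

/-- The coefficients of a quartic with three given roots. -/
lemma quartic_coeffs {a b c α γ S T U : K} (hab : a ≠ b) (hac : a ≠ c) (hbc : b ≠ c)
    (fa : α * a ^ 4 + γ * a ^ 3 + S * a ^ 2 + T * a + U = 0)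
    (fb : α * b ^ 4 + γ * b ^ 3 + S * b ^ 2 + T * b + U = 0)
    (fc : α * c ^ 4 + γ * c ^ 3 + S * c ^ 2 + T * c + U = 0) :
    U = a * b * c * (-α * (a + b + c) - γ) ∧
    S = α * (a * b + b * c + c * a) - (γ + α * (a + b + c)) * (a + b + c) ∧
    T = (γ + α * (a + b + c)) * (a * b + b * c + c * a) - α * (a * b * c) := by
  have gab : α * (a ^ 3 + a ^ 2 * b + a * b ^ 2 + b ^ 3) + γ * (a ^ 2 + a * b + b ^ 2)
      + S * (a + b) + T = 0 := by
    apply mul_left_cancel₀ (sub_ne_zero.mpr hab)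
    linear_combination fa - fb
  have gac : α * (a ^ 3 + a ^ 2 * c + a * c ^ 2 + c ^ 3) + γ * (a ^ 2 + a * c + c ^ 2)
      + S * (a + c) + T = 0 := by
    apply mul_left_cancel₀ (sub_ne_zero.mpr hac)
    linear_combination fa - fc
  have g : α * (a ^ 2 + b ^ 2 + c ^ 2 + a * b + b * c + c * a) + γ * (a + b + c) + S = 0 := by
    apply mul_left_cancel₀ (sub_ne_zero.mpr hbc)
    linear_combination gab - gac
  refine ⟨?_, ?_, ?_⟩
  · linear_combination fa - a * gab + a * b * g
  · linear_combination g
  · linear_combination gab - (a + b) * g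

/-- A conic through three points of the circle `w * wb = R`: its linear and constant coefficients
are determined by the remaining ones. Here `f` and `fb` are conjugate. -/
lemma coeffs_of_inscribed {R a b c ab bb cb f fb e1b α αb β γ γb δ : K}
    (hR : R ≠ 0) (hab : a ≠ b) (hac : a ≠ c) (hbc : b ≠ c)
    (ha : a * ab = R) (hb : b * bb = R) (hc : c * cb = R)
    (hf : f * R ^ 2 = a * b * c) (hffb : f * fb * R = 1)
    (he1b : a * b + b * c + c * a = f * R * e1b)
    (hEa : α * a ^ 2 + αb * ab ^ 2 + β * (a * ab) + γ * a + γb * ab + δ = 0)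
    (hEb : α * b ^ 2 + αb * bb ^ 2 + β * (b * bb) + γ * b + γb * bb + δ = 0)
    (hEc : α * c ^ 2 + αb * cb ^ 2 + β * (c * cb) + γ * c + γb * cb + δ = 0) :
    γ = -α * (a + b + c) - αb * fb * R ∧
    γb = -αb * e1b - α * f * R ∧
    β * R + δ = α * f * R * e1b + αb * fb * R * (a + b + c) := by
  obtain ⟨hU, hS, hT⟩ := quartic_coeffs hab hac hbc (quartic_of_conic ha hEa)
    (quartic_of_conic hb hEb) (quartic_of_conic hc hEc)
  have hU' : f * (-α * (a + b + c) - γ) = αb := by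
    apply mul_left_cancel₀ (pow_ne_zero 2 hR)
    rw [hU, ← hf]; ring
  have hγ : γ = -α * (a + b + c) - αb * fb * R := by
    linear_combination (-α * (a + b + c) - γ) * hffb - fb * R * hU'
  refine ⟨hγ, ?_, ?_⟩
  · apply mul_left_cancel₀ hR
    rw [hT, he1b, ← hf, hγ]
    linear_combination -αb * R * e1b * hffb
  · rw [hS, he1b, hγ]; ring

/-- A conic inscribed with the triangle and passing through `p`, with isogonal conjugate `p'`. -/
lemma coeff_of_mem {R f fb p p' pb pb' α αb β γ γb δ : K}
    (hN : p * pb - R ≠ 0) (hffb : f * fb * R = 1)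
    (hγ : γ = -α * (p + p' + f * (pb * pb')) - αb * fb * R)
    (hγb : γb = -αb * (pb + pb' + fb * (p * p')) - α * f * R)
    (hδ : β * R + δ = α * f * R * (pb + pb' + fb * (p * p'))
      + αb * fb * R * (p + p' + f * (pb * pb')))
    (hE : α * p ^ 2 + αb * pb ^ 2 + β * (p * pb) + γ * p + γb * pb + δ = 0) :
    β = α * f * pb' + αb * fb * p' := by
  apply mul_left_cancel₀ hN
  subst hγ hγb
  linear_combination -(α * p * p' + αb * pb * pb') * hffb + hE - hδ

/-- The polarity identity behind the tangency, for a conic in the net through the vertices of the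
triangle and `p`. -/
lemma polar_identity {R f fb p pb p' pb' d db α αb β γ γb : K}
    (hβ : β = α * f * pb' + αb * fb * p')
    (hγ : γ = -α * (p + p' + f * (pb * pb')) - αb * fb * R)
    (hγb : γb = -αb * (pb + pb' + fb * (p * p')) - α * f * R)
    (hd : d * (p' - p) = -f * R * (pb' - pb)) (hdb : db * (pb' - pb) = -fb * R * (p' - p))
    (hf : f * fb * R = 1) :
    ((d - p) * (2 * α * p + β * pb + γ) + (db - pb) * (2 * αb * pb + β * p + γb))
        * ((p' - p) * (pb' - pb))
      + (p * pb - R) * (α * (p' - p) ^ 2 + αb * (pb' - pb) ^ 2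
        + β * ((p' - p) * (pb' - pb))) = 0 := by
  have hd' : fb * d * (p' - p) = -(pb' - pb) := by
    linear_combination fb * hd - (pb' - pb) * hf
  have hdb' : f * db * (pb' - pb) = -(p' - p) := by
    linear_combination f * hdb - (p' - p) * hf
  subst hβ hγ hγb
  linear_combination α * ((p' - p) * (pb' * p - R)) * hdb'
    + αb * ((pb' - pb) * (p' * pb - R)) * hd'
    - (p' - p) * (pb' - pb) * (α * hd + αb * hdb)

/-- A point with an isogonal conjugate is on the circle only at a vertex. -/
lemma eq_vertex_of_mem_circle {R f fb a b c p p' pb pb' : K}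
    (hf : f * R ^ 2 = a * b * c) (hffb : f * fb * R = 1)
    (he1 : a + b + c = p + p' + f * (pb * pb'))
    (he2 : a * b + b * c + c * a = f * R * (pb + pb' + fb * (p * p')))
    (hp : p * pb = R) : p = a ∨ p = b ∨ p = c := by
  have h : (p - a) * (p - b) * (p - c) = 0 := by
    linear_combination -p ^ 2 * he1 + p * he2 + hf + p ^ 2 * p' * hffb + (f * R - f * p * pb') * hp
  rcases mul_eq_zero.mp h with h | h
  · rcases mul_eq_zero.mp h with h | h
    · exact Or.inl (sub_eq_zero.mp h)
    · exact Or.inr (Or.inl (sub_eq_zero.mp h))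
  · exact Or.inr (Or.inr (sub_eq_zero.mp h))

/-- The fourth intersection of the circle with an inscribed conic. -/
lemma fourth_intersection {R f fb e1b a b c d db α αb β γ γb δ : K}
    (hda : d ≠ a) (hdb : d ≠ b) (hdc : d ≠ c) (hd : d * db = R)
    (hf : f * R ^ 2 = a * b * c) (hffb : f * fb * R = 1)
    (he1b : a * b + b * c + c * a = f * R * e1b)
    (hγ : γ = -α * (a + b + c) - αb * fb * R) (hγb : γb = -αb * e1b - α * f * R)
    (hδ : β * R + δ = α * f * R * e1b + αb * fb * R * (a + b + c))
    (hE : α * d ^ 2 + αb * db ^ 2 + β * (d * db) + γ * d + γb * db + δ = 0) :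
    α * f * d = αb := by
  have h := quartic_of_conic hd hE
  rw [hδ, hγ, hγb] at h
  have h2 : (d - a) * ((d - b) * ((d - c) * (α * f * d - αb))) = 0 := by
    linear_combination f * h + αb * d ^ 3 * hffb
      - αb * (a + b + c) * d ^ 2 * hffb + (α * f * d ^ 2 - αb * d) * he1b
      + (α * f * d - αb) * hf
  have := mul_left_cancel₀ (sub_ne_zero.mpr hda) (h2.trans (mul_zero _).symm)
  have := mul_left_cancel₀ (sub_ne_zero.mpr hdb) (this.trans (mul_zero _).symm)
  have := mul_left_cancel₀ (sub_ne_zero.mpr hdc) (this.trans (mul_zero _).symm)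
  exact sub_eq_zero.mp this

end Algebra

section Plane

/-- The complex coefficient of `w ^ 2` in a real quadratic polynomial. -/
def leadCoeff (a b c : ℝ) : ℂ := ⟨(a - c) / 4, -b / 4⟩

lemma conicEval_eq (a b c d e f : ℝ) (o z : ℂ) :
    (conicEval a b c d e f z : ℂ) = leadCoeff a b c * (z - o) ^ 2
      + conj (leadCoeff a b c) * conj (z - o) ^ 2 + ((a + c) / 2 : ℝ) * ((z - o) * conj (z - o))
      + conj (conicGrad a b c d e f o) / 2 * (z - o) + conicGrad a b c d e f o / 2 * conj (z - o)
      + (conicEval a b c d e f o : ℂ) := by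
  apply Complex.ext <;>
    simp [conicEval, conicGrad, leadCoeff, pow_two] <;> ring

lemma conicGrad_eq (a b c d e f : ℝ) (o z : ℂ) :
    conicGrad a b c d e f z = 2 * (2 * conj (leadCoeff a b c) * conj (z - o)
      + ((a + c) / 2 : ℝ) * (z - o) + conicGrad a b c d e f o / 2) := by
  apply Complex.ext <;>
    simp [conicGrad, leadCoeff] <;> ring

/-- A quadratic polynomial vanishes if its complex coefficients do. -/
lemma coeffs_eq_zero {a b c d e f : ℝ} {o : ℂ} (hα : leadCoeff a b c = 0)
    (hβ : (a + c) / 2 = 0) (hγ : conicGrad a b c d e f o = 0)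
    (hδ : conicEval a b c d e f o = 0) :
    a = 0 ∧ b = 0 ∧ c = 0 ∧ d = 0 ∧ e = 0 ∧ f = 0 := by
  have h1 := congrArg Complex.re hα
  have h2 := congrArg Complex.im hα
  have h3 := congrArg Complex.re hγ
  have h4 := congrArg Complex.im hγ
  simp [leadCoeff] at h1 h2
  simp [conicGrad] at h3 h4
  have ha : a = 0 := by linarith
  have hc : c = 0 := by linarith
  have hb : b = 0 := by linarith
  subst ha hb hc
  simp at h3 h4
  subst h3 h4
  simp [conicEval] at hδ
  simp [hδ]

/-- The angle condition of isogonal conjugacy at a vertex of a triangle inscribed in a circle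
centered at the origin. -/
lemma isogonal_vertex {R a b c p p' : ℂ} (ha : a * conj a = R) (hb : b * conj b = R)
    (hc : c * conj c = R) (hab : a ≠ b) (hac : a ≠ c)
    (h : ((p - a) * (p' - a) / ((b - a) * (c - a))).im = 0) :
    (p - a) * (p' - a) * R ^ 2 = b * c * (a * conj p - R) * (a * conj p' - R) := by
  have hw : (b - a) * (c - a) ≠ 0 :=
    mul_ne_zero (sub_ne_zero.mpr hab.symm) (sub_ne_zero.mpr hac.symm)
  have hw' : conj ((b - a) * (c - a)) ≠ 0 := (map_ne_zero _).mpr hw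
  have hreal := Complex.conj_eq_iff_im.mpr h
  rw [map_div₀, div_eq_div_iff hw' hw] at hreal
  simp only [map_mul, map_sub] at hreal
  apply mul_left_cancel₀ hw
  generalize conj a = a' at *
  generalize conj b = b' at *
  generalize conj c = c' at *
  generalize conj p = q at *
  generalize conj p' = q' at *
  subst ha
  have e1 : b * (a * (b' - a')) = a * a' * (a - b) := by linear_combination a * hb
  have e2 : c * (a * (c' - a')) = a * a' * (a - c) := by linear_combination a * hc
  calc (b - a) * (c - a) * ((p - a) * (p' - a) * (a * a') ^ 2)
      = (p - a) * (p' - a) * ((a * a' * (a - b)) * (a * a' * (a - c))) := by ring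
    _ = b * c * a ^ 2 * ((p - a) * (p' - a) * ((b' - a') * (c' - a'))) := by
        rw [← e1, ← e2]; ring
    _ = _ := by rw [← hreal]; ring

/-- The symmetric functions of the vertices in terms of a pair of isogonal conjugates. -/
lemma isogonal_relations {R a b c p p' : ℂ} (hR : R ≠ 0) (hRr : conj R = R)
    (ha : a * conj a = R) (hb : b * conj b = R) (hc : c * conj c = R)
    (h : R ^ 2 * (p + p') + a * b * c * (conj p * conj p') = R ^ 2 * (a + b + c)) :
    ∃ f : ℂ, f * R ^ 2 = a * b * c ∧ f * conj f * R = 1 ∧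
      a + b + c = p + p' + f * (conj p * conj p') ∧
      a * b + b * c + c * a = f * R * (conj p + conj p' + conj f * (p * p')) := by
  have hf : a * b * c / R ^ 2 * R ^ 2 = a * b * c := div_mul_cancel₀ _ (pow_ne_zero 2 hR)
  have hfb := congrArg conj hf
  generalize a * b * c / R ^ 2 = f at hf hfb
  have he : a + b + c = p + p' + f * (conj p * conj p') := by
    apply mul_left_cancel₀ (pow_ne_zero 2 hR)
    linear_combination -h - (conj p * conj p') * hf
  have heb := congrArg conj he
  simp only [map_mul, map_add, map_pow, hRr, Complex.conj_conj] at hfb heb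
  refine ⟨f, hf, ?_, he, ?_⟩
  · apply mul_left_cancel₀ (pow_ne_zero 3 hR)
    calc R ^ 3 * (f * conj f * R) = (f * R ^ 2) * (conj f * R ^ 2) := by ring
      _ = (a * conj a) * (b * conj b) * (c * conj c) := by rw [hf, hfb]; ring
      _ = R ^ 3 * 1 := by rw [ha, hb, hc]; ring
  · rw [← heb]
    apply mul_left_cancel₀ hR
    linear_combination -a * b * hc - b * c * ha - c * a * hb - (conj a + conj b + conj c) * hf

lemma mul_conj_of_mem_circle {o z : ℂ} {r : ℝ} (h : z ∈ circleSet o r) :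
    (z - o) * conj (z - o) = ((r ^ 2 : ℝ) : ℂ) := by
  rw [Complex.mul_conj, Complex.normSq_eq_norm_sq, show ‖z - o‖ = r from h]

lemma collinear_of_det {u v w : ℂ}
    (h : (v - u).re * (w - u).im - (v - u).im * (w - u).re = 0) :
    Collinear ℝ ({u, v, w} : Set ℂ) := by
  by_cases huv : v = u
  · subst huv
    simpa using collinear_pair ℝ v w
  · rw [collinear_iff_of_mem (p₀ := u) (by simp)]
    have hn : (v - u).re ^ 2 + (v - u).im ^ 2 ≠ 0 := by
      intro h0
      apply huv
      apply sub_eq_zero.mp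
      apply Complex.ext
      · simp only [Complex.zero_re]; nlinarith [sq_nonneg (v - u).re, sq_nonneg (v - u).im]
      · simp only [Complex.zero_im]; nlinarith [sq_nonneg (v - u).re, sq_nonneg (v - u).im]
    refine ⟨v - u, ?_⟩
    rintro z (rfl | rfl | rfl)
    · exact ⟨0, by simp⟩
    · exact ⟨1, by simp⟩
    · refine ⟨((v - u).re * (z - u).re + (v - u).im * (z - u).im)
        / ((v - u).re ^ 2 + (v - u).im ^ 2), ?_⟩
      rw [vadd_eq_add, ← sub_eq_iff_eq_add]
      apply Complex.ext
      · rw [Complex.real_smul, Complex.re_ofReal_mul, div_mul_eq_mul_div, eq_div_iff hn]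
        linear_combination -(v - u).im * h
      · rw [Complex.real_smul, Complex.im_ofReal_mul, div_mul_eq_mul_div, eq_div_iff hn]
        linear_combination (v - u).re * h

/-- A binary quadratic form with three pairwise independent zeros vanishes. -/
lemma binary_form_eq_zero {a b c x₁ y₁ x₂ y₂ x₃ y₃ : ℝ}
    (h₁ : a * x₁ ^ 2 + b * x₁ * y₁ + c * y₁ ^ 2 = 0)
    (h₂ : a * x₂ ^ 2 + b * x₂ * y₂ + c * y₂ ^ 2 = 0)
    (h₃ : a * x₃ ^ 2 + b * x₃ * y₃ + c * y₃ ^ 2 = 0)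
    (h₁₂ : x₁ * y₂ - y₁ * x₂ ≠ 0) (h₁₃ : x₁ * y₃ - y₁ * x₃ ≠ 0)
    (h₂₃ : x₂ * y₃ - y₂ * x₃ ≠ 0) : a = 0 ∧ b = 0 ∧ c = 0 := by
  have hD := mul_ne_zero (mul_ne_zero h₁₂ h₁₃) h₂₃
  refine ⟨?_, ?_, ?_⟩ <;> apply mul_left_cancel₀ hD
  · linear_combination (x₂ * y₃ - y₂ * x₃) * y₂ * y₃ * h₁ - (x₁ * y₃ - y₁ * x₃) * y₁ * y₃ * h₂
      + (x₁ * y₂ - y₁ * x₂) * y₁ * y₂ * h₃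
  · linear_combination -(x₂ * y₃ - y₂ * x₃) * (x₂ * y₃ + x₃ * y₂) * h₁
      + (x₁ * y₃ - y₁ * x₃) * (x₁ * y₃ + x₃ * y₁) * h₂
      - (x₁ * y₂ - y₁ * x₂) * (x₁ * y₂ + x₂ * y₁) * h₃
  · linear_combination (x₂ * y₃ - y₂ * x₃) * x₂ * x₃ * h₁ - (x₁ * y₃ - y₁ * x₃) * x₁ * x₃ * h₂
      + (x₁ * y₂ - y₁ * x₂) * x₁ * x₂ * h₃

lemma conicEval_taylor (a b c d e f : ℝ) (z w : ℂ) :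
    conicEval a b c d e f w = conicEval a b c d e f z
      + ((conicGrad a b c d e f z).re * (w - z).re + (conicGrad a b c d e f z).im * (w - z).im)
      + (a * (w - z).re ^ 2 + b * (w - z).re * (w - z).im + c * (w - z).im ^ 2) := by
  simp [conicEval, conicGrad]; ring

/-- A conic is smooth at a point that sees three other points of the conic in different
directions. -/
lemma conicGrad_ne_zero {a b c d e f : ℝ} {z w₁ w₂ w₃ : ℂ}
    (hne : ¬(a = 0 ∧ b = 0 ∧ c = 0 ∧ d = 0 ∧ e = 0 ∧ f = 0))
    (hz : conicEval a b c d e f z = 0) (h₁ : conicEval a b c d e f w₁ = 0)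
    (h₂ : conicEval a b c d e f w₂ = 0) (h₃ : conicEval a b c d e f w₃ = 0)
    (h₁₂ : ¬ Collinear ℝ ({z, w₁, w₂} : Set ℂ)) (h₁₃ : ¬ Collinear ℝ ({z, w₁, w₃} : Set ℂ))
    (h₂₃ : ¬ Collinear ℝ ({z, w₂, w₃} : Set ℂ)) : conicGrad a b c d e f z ≠ 0 := by
  intro hg
  rw [conicEval_taylor a b c d e f z, hz, hg] at h₁ h₂ h₃
  simp only [Complex.zero_re, Complex.zero_im, zero_mul, zero_add] at h₁ h₂ h₃
  obtain ⟨rfl, rfl, rfl⟩ := binary_form_eq_zero h₁ h₂ h₃ (mt collinear_of_det h₁₂)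
    (mt collinear_of_det h₁₃) (mt collinear_of_det h₂₃)
  exact hne (coeffs_eq_zero (o := z) (by simp [leadCoeff, Complex.ext_iff]) (by simp) hg hz)

lemma conic_mem_centered {k₁ k₂ k₃ k₄ k₅ k₆ : ℝ} (o : ℂ) {z : ℂ}
    (h : conicEval k₁ k₂ k₃ k₄ k₅ k₆ z = 0) :
    leadCoeff k₁ k₂ k₃ * (z - o) ^ 2 + conj (leadCoeff k₁ k₂ k₃) * conj (z - o) ^ 2
      + ((k₁ + k₃) / 2 : ℝ) * ((z - o) * conj (z - o))
      + conj (conicGrad k₁ k₂ k₃ k₄ k₅ k₆ o) / 2 * (z - o)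
      + conicGrad k₁ k₂ k₃ k₄ k₅ k₆ o / 2 * conj (z - o)
      + (conicEval k₁ k₂ k₃ k₄ k₅ k₆ o : ℂ) = 0 := by
  rw [← conicEval_eq, h, Complex.ofReal_zero]

/-- The fourth common point `D` of the circumcircle and the conic through the vertices and a pair
of isogonal conjugates is the isogonal conjugate of the point at infinity of the line joining the
pair; here everything is expressed relative to the circumcenter `o`. -/
lemma fourth_point_direction {k₁ k₂ k₃ k₄ k₅ k₆ : ℝ} {o A B C P P' D R f : ℂ} (hR : R ≠ 0)
    (hne : ¬(k₁ = 0 ∧ k₂ = 0 ∧ k₃ = 0 ∧ k₄ = 0 ∧ k₅ = 0 ∧ k₆ = 0))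
    (hAB : A ≠ B) (hAC : A ≠ C) (hBC : B ≠ C) (hDA : D ≠ A) (hDB : D ≠ B) (hDC : D ≠ C)
    (hA : (A - o) * conj (A - o) = R) (hB : (B - o) * conj (B - o) = R)
    (hC : (C - o) * conj (C - o) = R) (hD : (D - o) * conj (D - o) = R)
    (hP : (P - o) * conj (P - o) - R ≠ 0) (hP' : (P' - o) * conj (P' - o) - R ≠ 0)
    (hf : f * R ^ 2 = (A - o) * (B - o) * (C - o)) (hff : f * conj f * R = 1)
    (he1 : (A - o) + (B - o) + (C - o) = (P - o) + (P' - o) + f * (conj (P - o) * conj (P' - o)))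
    (he2 : (A - o) * (B - o) + (B - o) * (C - o) + (C - o) * (A - o) =
      f * R * (conj (P - o) + conj (P' - o) + conj f * ((P - o) * (P' - o))))
    (hHA : conicEval k₁ k₂ k₃ k₄ k₅ k₆ A = 0) (hHB : conicEval k₁ k₂ k₃ k₄ k₅ k₆ B = 0)
    (hHC : conicEval k₁ k₂ k₃ k₄ k₅ k₆ C = 0) (hHP : conicEval k₁ k₂ k₃ k₄ k₅ k₆ P = 0)
    (hHP' : conicEval k₁ k₂ k₃ k₄ k₅ k₆ P' = 0) (hHD : conicEval k₁ k₂ k₃ k₄ k₅ k₆ D = 0) :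
    (D - o) * ((P' - o) - (P - o)) = -f * R * (conj (P' - o) - conj (P - o)) := by
  have hsub : ∀ {z w : ℂ}, z ≠ w → z - o ≠ w - o := fun h h' => h (sub_left_injective h')
  have hα : leadCoeff k₁ k₂ k₃ = 0 → False := by
    intro hα
    obtain ⟨hγ, -, hδ⟩ := coeffs_of_inscribed hR (hsub hAB) (hsub hAC) (hsub hBC) hA hB hC hf hff
      he2 (conic_mem_centered o hHA) (conic_mem_centered o hHB) (conic_mem_centered o hHC)
    have hHP := conic_mem_centered o hHP
    simp only [hα, map_zero, neg_zero, zero_mul, sub_zero, add_zero] at hγ hδ hHP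
    have hg : conicGrad k₁ k₂ k₃ k₄ k₅ k₆ o = 0 := by simpa using hγ
    have hβ : (((k₁ + k₃) / 2 : ℝ) : ℂ) = 0 := by
      apply mul_left_cancel₀ hP
      simp only [hg, map_zero] at hHP
      linear_combination hHP - hδ
    rw [hβ, zero_mul, zero_add] at hδ
    exact hne (coeffs_eq_zero hα (by exact_mod_cast hβ) hg (by exact_mod_cast hδ))
  obtain ⟨hγ, hγb, hδ⟩ := coeffs_of_inscribed hR (hsub hAB) (hsub hAC) (hsub hBC) hA hB hC hf hff
    he2 (conic_mem_centered o hHA) (conic_mem_centered o hHB) (conic_mem_centered o hHC)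
  have hfd := fourth_intersection (hsub hDA) (hsub hDB) (hsub hDC) hD hf hff he2 hγ hγb hδ
    (conic_mem_centered o hHD)
  rw [he1] at hγ hδ
  have h1 := coeff_of_mem hP hff hγ hγb hδ (conic_mem_centered o hHP)
  have h2 := coeff_of_mem (p := P' - o) (p' := P - o) (pb := conj (P' - o)) (pb' := conj (P - o))
    (f := f) (fb := conj f) hP' hff (by rw [hγ]; ring) (by rw [hγb]; ring) (by rw [hδ]; ring)
    (conic_mem_centered o hHP')
  apply mul_left_cancel₀ hα
  linear_combination (leadCoeff k₁ k₂ k₃ * (D - o) * (P' - P)) * (-hff)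
    + conj f * R * (P' - P) * hfd + R * (h2 - h1)

/-- The polarity identity for a conic through the vertices and `P`. -/
lemma polar_identity_conic {k₁ k₂ k₃ k₄ k₅ k₆ : ℝ} {o A B C P P' D R f : ℂ} (hR : R ≠ 0)
    (hRr : conj R = R) (hAB : A ≠ B) (hAC : A ≠ C) (hBC : B ≠ C)
    (hA : (A - o) * conj (A - o) = R) (hB : (B - o) * conj (B - o) = R)
    (hC : (C - o) * conj (C - o) = R)
    (hP : (P - o) * conj (P - o) - R ≠ 0)
    (hf : f * R ^ 2 = (A - o) * (B - o) * (C - o)) (hff : f * conj f * R = 1)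
    (he1 : (A - o) + (B - o) + (C - o) = (P - o) + (P' - o) + f * (conj (P - o) * conj (P' - o)))
    (he2 : (A - o) * (B - o) + (B - o) * (C - o) + (C - o) * (A - o) =
      f * R * (conj (P - o) + conj (P' - o) + conj f * ((P - o) * (P' - o))))
    (hEA : conicEval k₁ k₂ k₃ k₄ k₅ k₆ A = 0) (hEB : conicEval k₁ k₂ k₃ k₄ k₅ k₆ B = 0)
    (hEC : conicEval k₁ k₂ k₃ k₄ k₅ k₆ C = 0) (hEP : conicEval k₁ k₂ k₃ k₄ k₅ k₆ P = 0)
    (hd : (D - o) * ((P' - o) - (P - o)) = -f * R * (conj (P' - o) - conj (P - o))) :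
    ((D - P) * conj (conicGrad k₁ k₂ k₃ k₄ k₅ k₆ P) / 2
        + conj (D - P) * conicGrad k₁ k₂ k₃ k₄ k₅ k₆ P / 2) * ((P' - P) * conj (P' - P))
      + ((P - o) * conj (P - o) - R) * (leadCoeff k₁ k₂ k₃ * (P' - P) ^ 2
        + conj (leadCoeff k₁ k₂ k₃) * conj (P' - P) ^ 2
        + ((k₁ + k₃) / 2 : ℝ) * ((P' - P) * conj (P' - P))) = 0 := by
  have hsub : ∀ {z w : ℂ}, z ≠ w → z - o ≠ w - o := fun h h' => h (sub_left_injective h')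
  obtain ⟨hγ, hγb, hδ⟩ := coeffs_of_inscribed hR (hsub hAB) (hsub hAC) (hsub hBC) hA hB hC hf hff
    he2 (conic_mem_centered o hEA) (conic_mem_centered o hEB) (conic_mem_centered o hEC)
  rw [he1] at hγ hδ
  have hβ := coeff_of_mem hP hff hγ hγb hδ (conic_mem_centered o hEP)
  have hdb := congrArg conj hd
  simp only [map_mul, map_sub, map_neg, Complex.conj_conj, hRr] at hdb
  have key := polar_identity hβ hγ hγb hd (db := conj (D - o))
    (by simp only [map_sub]; linear_combination hdb) hff
  rw [conicGrad_eq k₁ k₂ k₃ k₄ k₅ k₆ o P]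
  simp only [map_sub, map_mul, map_add, map_ofNat, map_div₀, Complex.conj_conj,
    Complex.conj_ofReal] at key ⊢
  linear_combination key

/-- The real form of the polarity identity, after passing from `D` to the second intersection `X`
of `DP` with the circumcircle. -/
lemma polar_identity_real {k₁ k₂ k₃ s N : ℝ} {P P' D X g : ℂ}
    (hX : X - P = s • (D - P)) (hs : s * Complex.normSq (D - P) = N)
    (h : ((D - P) * conj g / 2 + conj (D - P) * g / 2) * ((P' - P) * conj (P' - P))
      + N * (leadCoeff k₁ k₂ k₃ * (P' - P) ^ 2
        + conj (leadCoeff k₁ k₂ k₃) * conj (P' - P) ^ 2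
        + ((k₁ + k₃) / 2 : ℝ) * ((P' - P) * conj (P' - P))) = 0) :
    (g.re * (X - P).re + g.im * (X - P).im) * Complex.normSq (P' - P)
      + Complex.normSq (X - P) * (k₁ * (P' - P).re ^ 2 + k₂ * (P' - P).re * (P' - P).im
        + k₃ * (P' - P).im ^ 2) = 0 := by
  have h1 := congrArg Complex.re h
  rw [Complex.zero_re] at h1
  rw [hX, ← mul_zero s, ← h1]
  generalize D - P = v at *
  generalize P' - P = u at *
  subst hs
  simp [leadCoeff, pow_two, Complex.normSq_apply]
  ring

lemma normSq_of_mem_circle {o z : ℂ} {r : ℝ} (h : z ∈ circleSet o r) :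
    (z - o).re ^ 2 + (z - o).im ^ 2 = r ^ 2 := by
  rw [← show ‖z - o‖ = r from h, ← Complex.normSq_eq_norm_sq, Complex.normSq_apply]
  ring

/-- The power of a point on a secant `DX` of a circle. -/
lemma power_of_secant {o D X P : ℂ} {r : ℝ} (hD : D ∈ circleSet o r) (hX : X ∈ circleSet o r)
    (hXD : X ≠ D) (hline : X ∈ lineThrough D P) :
    ∃ s : ℝ, X - P = s • (D - P) ∧
      s * Complex.normSq (D - P) = Complex.normSq (P - o) - r ^ 2 := by
  obtain ⟨t, rfl⟩ := hline
  have ht : t ≠ 0 := by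
    rintro rfl
    simp at hXD
  have h1 := normSq_of_mem_circle hD
  have h2 := normSq_of_mem_circle hX
  refine ⟨1 - t, ?_, ?_⟩
  · simp only [Complex.real_smul, Complex.ofReal_sub, Complex.ofReal_one]; ring
  · apply mul_left_cancel₀ ht
    simp only [Complex.normSq_apply, Complex.real_smul, Complex.sub_re, Complex.sub_im,
      Complex.add_re, Complex.add_im, Complex.re_ofReal_mul, Complex.im_ofReal_mul] at h1 h2 ⊢
    linear_combination (1 - t) * h1 - h2

lemma chord_of_circle {o z w : ℂ} {r : ℝ} (hz : z ∈ circleSet o r) (hw : w ∈ circleSet o r) :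
    2 * ((o - z).re * (w - z).re + (o - z).im * (w - z).im) = Complex.normSq (w - z) := by
  have h1 := normSq_of_mem_circle hz
  have h2 := normSq_of_mem_circle hw
  simp [Complex.normSq_apply] at h1 h2 ⊢
  linear_combination h1 - h2

/-- A vector is determined by its inner products with two independent vectors. -/
lemma eq_of_inner_eq {u v g h : ℂ} (hdet : u.re * v.im - u.im * v.re ≠ 0)
    (hu : g.re * u.re + g.im * u.im = h.re * u.re + h.im * u.im)
    (hv : g.re * v.re + g.im * v.im = h.re * v.re + h.im * v.im) : g = h := by
  apply Complex.ext <;> apply mul_left_cancel₀ hdet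
  · linear_combination v.im * hu - u.im * hv
  · linear_combination u.re * hv - v.re * hu

lemma perpLineAt_eq_of_smul {z g n : ℂ} {k : ℝ} (hk : k ≠ 0) (hg : g = k • n) :
    perpLineAt z (-n) = perpLineAt z g := by
  ext w
  simp only [perpLineAt, Set.mem_ofPred_eq, hg, Complex.smul_re, Complex.smul_im, smul_eq_mul,
    Complex.neg_re, Complex.neg_im]
  constructor
  · intro h; linear_combination -k * h
  · intro h
    apply mul_left_cancel₀ hk
    linear_combination -h

end Plane

end IsogonalConic

theorem statement3 (A B C O : ℂ) (r : ℝ) (Ω : Set ℂ)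
    (hr : 0 < r) (hΩ : Ω = circleSet O r)
    (hAΩ : A ∈ Ω) (hBΩ : B ∈ Ω) (hCΩ : C ∈ Ω)
    (hABC : ¬ Collinear ℝ ({A, B, C} : Set ℂ))
    (P P' : ℂ) (hPP : P ≠ P') (hconj : IsogConj A B C P P')
    (h5 : NoThreeCollinear [A, B, C, P, P'])
    (Q : ℂ) (hQP : Q ≠ P) (hQline : Q ∈ lineThrough P P')
    (h5Q : NoThreeCollinear [A, B, C, P, Q])
    (H : Set ℂ) (hH : IsConic H)
    (hAH : A ∈ H) (hBH : B ∈ H) (hCH : C ∈ H) (hPH : P ∈ H) (hPH2 : P' ∈ H)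
    (D : ℂ) (hDΩ : D ∈ Ω) (hDH : D ∈ H) (hDA : D ≠ A) (hDB : D ≠ B) (hDC : D ≠ C)
    (hDP : D ≠ P)
    (X : ℂ) (hXD : X ≠ D) (hXΩ : X ∈ Ω) (hXline : X ∈ lineThrough D P)
    (hPQX : ¬ Collinear ℝ ({P, Q, X} : Set ℂ))
    (O₁ : ℂ) (r₁ : ℝ) (hr₁ : 0 < r₁)
    (hPγ : P ∈ circleSet O₁ r₁) (hQγ : Q ∈ circleSet O₁ r₁) (hXγ : X ∈ circleSet O₁ r₁)
    (E : Set ℂ) (hE : IsConic E)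
    (hAE : A ∈ E) (hBE : B ∈ E) (hCE : C ∈ E) (hPE : P ∈ E) (hQE : Q ∈ E) :
    CircleConicTangentAt O₁ r₁ E P := by
  open IsogonalConic ComplexConjugate in
  subst hΩ
  obtain ⟨k₁, k₂, k₃, k₄, k₅, k₆, hkne, rfl⟩ := hE
  obtain ⟨m₁, m₂, m₃, m₄, m₅, m₆, hmne, rfl⟩ := hH
  simp only [Set.mem_ofPred_eq] at hAE hBE hCE hPE hQE hAH hBH hCH hPH hPH2 hDH
  have hcol : ∀ i j k : Fin 5, i ≠ j → i ≠ k → j ≠ k →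
      ¬ Collinear ℝ ({[A, B, C, P, P'].get i, [A, B, C, P, P'].get j, [A, B, C, P, P'].get k} :
        Set ℂ) := h5
  have hPAB : ¬ Collinear ℝ ({P, A, B} : Set ℂ) :=
    hcol 3 0 1 (by decide) (by decide) (by decide)
  have hPAC : ¬ Collinear ℝ ({P, A, C} : Set ℂ) :=
    hcol 3 0 2 (by decide) (by decide) (by decide)
  have hPBC : ¬ Collinear ℝ ({P, B, C} : Set ℂ) :=
    hcol 3 1 2 (by decide) (by decide) (by decide)
  have hP'AB : ¬ Collinear ℝ ({P', A, B} : Set ℂ) :=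
    hcol 4 0 1 (by decide) (by decide) (by decide)
  have hP'CB : ¬ Collinear ℝ ({P', C, B} : Set ℂ) :=
    hcol 4 2 1 (by decide) (by decide) (by decide)
  have hne : ∀ {u v w : ℂ}, ¬ Collinear ℝ ({u, v, w} : Set ℂ) → u ≠ v ∧ u ≠ w ∧ v ≠ w := by
    intro u v w h
    refine ⟨?_, ?_, ?_⟩ <;> rintro rfl <;> exact h (collinear_of_det (by simp [mul_comm]))
  obtain ⟨hAB, hAC, hBC⟩ := hne hABC
  have hA := mul_conj_of_mem_circle hAΩ
  have hB := mul_conj_of_mem_circle hBΩ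
  have hC := mul_conj_of_mem_circle hCΩ
  have hD := mul_conj_of_mem_circle hDΩ
  have hR : ((r ^ 2 : ℝ) : ℂ) ≠ 0 := Complex.ofReal_ne_zero.mpr (by positivity)
  have hsub : ∀ {z w : ℂ}, z ≠ w → z - O ≠ w - O := fun h h' => h (sub_left_injective h')
  obtain ⟨hcA, hcB, -⟩ := hconj
  have hsum := isogonal_sum (hsub hAB)
    (isogonal_vertex (p := P - O) (p' := P' - O) hA hB hC (hsub hAB) (hsub hAC)
      (by simpa only [sub_sub_sub_cancel_right] using hcA))
    (isogonal_vertex (p := P - O) (p' := P' - O) hB hC hA (hsub hBC) (hsub hAB.symm)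
      (by simpa only [sub_sub_sub_cancel_right] using hcB))
  obtain ⟨f, hf, hff, he1, he2⟩ :=
    isogonal_relations hR (Complex.conj_ofReal _) hA hB hC hsum
  have hPcirc : (P - O) * conj (P - O) - ((r ^ 2 : ℝ) : ℂ) ≠ 0 := by
    intro h
    rcases eq_vertex_of_mem_circle hf hff he1 he2 (sub_eq_zero.mp h) with h | h | h
    · exact (hne hPAB).1 (sub_left_injective h)
    · exact (hne hPAB).2.1 (sub_left_injective h)
    · exact (hne hPAC).2.1 (sub_left_injective h)
  have hP'circ : (P' - O) * conj (P' - O) - ((r ^ 2 : ℝ) : ℂ) ≠ 0 := by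
    intro h
    rcases eq_vertex_of_mem_circle (p' := P - O) (pb' := conj (P - O)) hf hff
      (by rw [he1]; ring) (by rw [he2]; ring) (sub_eq_zero.mp h) with h | h | h
    · exact (hne hP'AB).1 (sub_left_injective h)
    · exact (hne hP'AB).2.1 (sub_left_injective h)
    · exact (hne hP'CB).1 (sub_left_injective h)
  have hdir := fourth_point_direction hR hmne hAB hAC hBC hDA hDB hDC hA hB hC hD hPcirc hP'circ
    hf hff he1 he2 hAH hBH hCH hPH hPH2 hDH
  have hpol := polar_identity_conic hR (Complex.conj_ofReal _) hAB hAC hBC hA hB hC hPcirc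
    hf hff he1 he2 hAE hBE hCE hPE hdir
  obtain ⟨s, hs, hsN⟩ := power_of_secant hDΩ hXΩ hXD hXline
  rw [Complex.mul_conj (P - O), ← Complex.ofReal_sub] at hpol
  have hreal := polar_identity_real hs hsN hpol
  have hgne := conicGrad_ne_zero hkne hPE hAE hBE hCE hPAB hPAC hPBC
  obtain ⟨t, ht⟩ := hQline
  have hQ : Q - P = t • (P' - P) := by rw [ht]; ring
  have ht0 : t ≠ 0 := by
    rintro rfl
    exact hQP (sub_eq_zero.mp (by simpa using hQ))
  have hQeq := conicEval_taylor k₁ k₂ k₃ k₄ k₅ k₆ P Q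
  rw [hQE, hPE] at hQeq
  have hcQ := chord_of_circle hPγ hQγ
  have hcX := chord_of_circle hPγ hXγ
  have hdet := mt collinear_of_det hPQX
  have hu : Complex.normSq (P' - P) ≠ 0 :=
    fun h => hPP (sub_eq_zero.mp (Complex.normSq_eq_zero.mp h)).symm
  obtain ⟨κ, hκ⟩ : ∃ κ : ℝ, κ * Complex.normSq (P' - P) = -2 * (k₁ * (P' - P).re ^ 2
      + k₂ * (P' - P).re * (P' - P).im + k₃ * (P' - P).im ^ 2) :=
    ⟨_, div_mul_cancel₀ _ hu⟩
  have hg : conicGrad k₁ k₂ k₃ k₄ k₅ k₆ P = κ • (O₁ - P) := by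
    refine eq_of_inner_eq hdet ?_ ?_
    · rw [hQ] at hQeq hcQ ⊢
      simp only [Complex.real_smul, map_mul, Complex.normSq_ofReal, Complex.re_ofReal_mul,
        Complex.im_ofReal_mul] at hQeq hcQ ⊢
      linear_combination -hQeq - κ / 2 * hcQ - t ^ 2 / 2 * hκ
    · apply mul_left_cancel₀ hu
      simp only [Complex.smul_re, Complex.smul_im, smul_eq_mul]
      linear_combination hreal - κ / 2 * Complex.normSq (P' - P) * hcX
        - Complex.normSq (X - P) / 2 * hκ
  have hκ0 : κ ≠ 0 := by
    rintro rfl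
    exact hgne (by simpa using hg)
  refine ⟨hPγ, hPE, k₁, k₂, k₃, k₄, k₅, k₆, hkne, rfl, hPE, hgne, ?_⟩
  rw [← neg_sub O₁ P]
  exact perpLineAt_eq_of_smul hκ0 hg

end
end

section
/- Assume the main configuration. Then the circle through P, X, Y and the conic (ABCPZ) are tangent at P and are tangent at Z (at each of these two points both curves pass through the point and have the same tangent line there), provided no three of A, B, C, P, Z are collinear. -/
noncomputable section

open scoped ComplexConjugate

/-- Twice the signed area of the triangle `ABC`. -/
def signedArea (A B C : ℂ) : ℝ :=
  (B.re - A.re) * (C.im - A.im) - (B.im - A.im) * (C.re - A.re)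

lemma collinear_of_signedArea_eq_zero {A B C : ℂ} (h : signedArea A B C = 0) :
    Collinear ℝ ({A, B, C} : Set ℂ) := by
  by_cases hAB : A = B
  · subst hAB
    simpa using collinear_pair ℝ A C
  rw [collinear_iff_of_mem (p₀ := A) (by simp)]
  have hpos : (B.re - A.re) ^ 2 + (B.im - A.im) ^ 2 ≠ 0 := by
    intro h0
    apply hAB
    apply Complex.ext <;> nlinarith [sq_nonneg (B.re - A.re), sq_nonneg (B.im - A.im)]
  unfold signedArea at h
  refine ⟨B - A, ?_⟩
  intro p hp
  simp only [Set.mem_insert_iff, Set.mem_singleton_iff] at hp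
  rcases hp with rfl | rfl | rfl
  · exact ⟨0, by simp⟩
  · exact ⟨1, by simp⟩
  · refine ⟨((p.re - A.re) * (B.re - A.re) + (p.im - A.im) * (B.im - A.im)) /
      ((B.re - A.re) ^ 2 + (B.im - A.im) ^ 2), ?_⟩
    apply Complex.ext
    · simp only [vadd_eq_add, Complex.add_re, Complex.real_smul, Complex.re_ofReal_mul,
        Complex.sub_re]
      field_simp
      linear_combination (-(B.im - A.im)) * h
    · simp only [vadd_eq_add, Complex.add_im, Complex.real_smul, Complex.im_ofReal_mul,
        Complex.sub_im]
      field_simp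
      linear_combination (B.re - A.re) * h

/-- An affine function vanishing at three noncollinear points is zero. -/
lemma affine_coeffs_eq_zero {α β γ a₁ a₂ b₁ b₂ c₁ c₂ : ℝ}
    (hA : α + β * a₁ + γ * a₂ = 0) (hB : α + β * b₁ + γ * b₂ = 0)
    (hC : α + β * c₁ + γ * c₂ = 0)
    (h : (b₁ - a₁) * (c₂ - a₂) - (b₂ - a₂) * (c₁ - a₁) ≠ 0) : α = 0 ∧ β = 0 ∧ γ = 0 := by
  have hβ : β = 0 := by
    apply mul_left_cancel₀ h
    linear_combination (c₂ - a₂) * (hB - hA) - (b₂ - a₂) * (hC - hA)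
  have hγ : γ = 0 := by
    apply mul_left_cancel₀ h
    linear_combination (b₁ - a₁) * (hC - hA) - (c₁ - a₁) * (hB - hA)
  refine ⟨?_, hβ, hγ⟩
  simpa [hβ, hγ] using hA

/-- A quadratic polynomial vanishing at `P`, `Z` and their midpoint, and at three noncollinear
points off the line `PZ`, is zero. -/
lemma conic_coeffs_eq_zero {a b c d e f : ℝ} {A B C P Z : ℂ}
    (hA : conicEval a b c d e f A = 0) (hB : conicEval a b c d e f B = 0)
    (hC : conicEval a b c d e f C = 0) (hP : conicEval a b c d e f P = 0)
    (hZ : conicEval a b c d e f Z = 0) (hM : conicEval a b c d e f ((P + Z) / 2) = 0)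
    (hABC : signedArea A B C ≠ 0) (hPZA : signedArea P Z A ≠ 0)
    (hPZB : signedArea P Z B ≠ 0) (hPZC : signedArea P Z C ≠ 0) :
    a = 0 ∧ b = 0 ∧ c = 0 ∧ d = 0 ∧ e = 0 ∧ f = 0 := by
  obtain ⟨a₁, a₂⟩ := A
  obtain ⟨b₁, b₂⟩ := B
  obtain ⟨c₁, c₂⟩ := C
  obtain ⟨p₁, p₂⟩ := P
  obtain ⟨z₁, z₂⟩ := Z
  have h2re : (((⟨p₁, p₂⟩ : ℂ) + ⟨z₁, z₂⟩) / 2).re = (p₁ + z₁) / 2 := by simp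
  have h2im : (((⟨p₁, p₂⟩ : ℂ) + ⟨z₁, z₂⟩) / 2).im = (p₂ + z₂) / 2 := by simp
  simp only [conicEval, signedArea, h2re, h2im] at *
  obtain ⟨u, hu⟩ : ∃ u, u = z₁ - p₁ := ⟨_, rfl⟩
  obtain ⟨v, hv⟩ : ∃ v, v = z₂ - p₂ := ⟨_, rfl⟩
  obtain rfl : z₁ = p₁ + u := by linarith
  obtain rfl : z₂ = p₂ + v := by linarith
  clear hu hv h2re h2im
  obtain ⟨g, hg⟩ : ∃ g, g = 2 * a * p₁ + b * p₂ + d := ⟨_, rfl⟩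
  obtain ⟨k, hk⟩ : ∃ k, k = b * p₁ + 2 * c * p₂ + e := ⟨_, rfl⟩
  obtain ⟨m, hm⟩ : ∃ m, m = 2 * (c - a) * (u * v) + b * (u ^ 2 - v ^ 2) := ⟨_, rfl⟩
  obtain ⟨n, hn⟩ : ∃ n, n = a * v ^ 2 - b * u * v + c * u ^ 2 := ⟨_, rfl⟩
  have hquad : a * u ^ 2 + b * u * v + c * v ^ 2 = 0 := by
    linear_combination 2 * hZ + 2 * hP - 4 * hM
  have hlin : g * u + k * v = 0 := by
    rw [hg, hk]
    linear_combination hZ - hP - hquad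
  have hne : u ^ 2 + v ^ 2 ≠ 0 := by
    intro h0
    have hu0 : u = 0 := pow_eq_zero_iff two_ne_zero |>.1 (by linarith [sq_nonneg u, sq_nonneg v])
    have hv0 : v = 0 := pow_eq_zero_iff two_ne_zero |>.1 (by linarith [sq_nonneg u, sq_nonneg v])
    simp [hu0, hv0] at hPZA
  -- The polynomial is the equation of the line `PZ` times an affine function.
  have key : ∀ x y : ℝ, a * x ^ 2 + b * x * y + c * y ^ 2 + d * x + e * y + f = 0 →
      (p₁ + u - p₁) * (y - p₂) - (p₂ + v - p₂) * (x - p₁) ≠ 0 →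
      ((u ^ 2 + v ^ 2) * (k * u - g * v) - (m * u - n * v) * p₁ - (m * v + n * u) * p₂) +
        (m * u - n * v) * x + (m * v + n * u) * y = 0 := by
    intro x y hxy hline
    apply mul_left_cancel₀ hline
    have hdiff : g * (x - p₁) + k * (y - p₂) + (a * (x - p₁) ^ 2 +
        b * (x - p₁) * (y - p₂) + c * (y - p₂) ^ 2) = 0 := by
      rw [hg, hk]
      linear_combination hxy - hP
    rw [hm, hn]
    linear_combination (u ^ 2 + v ^ 2) ^ 2 * hdiff
      - (u ^ 2 + v ^ 2) * (u * (x - p₁) + v * (y - p₂)) * hlin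
      - (u * (x - p₁) + v * (y - p₂)) ^ 2 * hquad
  obtain ⟨h0, h1, h2⟩ := affine_coeffs_eq_zero (key _ _ hA hPZA) (key _ _ hB hPZB)
    (key _ _ hC hPZC) hABC
  have hm0 : m = 0 := by
    apply mul_left_cancel₀ hne
    linear_combination u * h1 + v * h2
  have hn0 : n = 0 := by
    apply mul_left_cancel₀ hne
    linear_combination u * h2 - v * h1
  have hperp : k * u - g * v = 0 := by
    apply mul_left_cancel₀ hne
    linear_combination h0 + p₁ * h1 + p₂ * h2
  have hg0 : g = 0 := by
    apply mul_left_cancel₀ hne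
    linear_combination u * hlin - v * hperp
  have hk0 : k = 0 := by
    apply mul_left_cancel₀ hne
    linear_combination v * hlin + u * hperp
  have ha : a = 0 := by
    apply mul_left_cancel₀ (pow_ne_zero 2 hne)
    linear_combination u ^ 2 * hquad - u * v * (hm0 - hm) + v ^ 2 * (hn0 - hn)
  have hc : c = 0 := by
    apply mul_left_cancel₀ (pow_ne_zero 2 hne)
    linear_combination v ^ 2 * hquad + u * v * (hm0 - hm) + u ^ 2 * (hn0 - hn)
  have hb : b = 0 := by
    apply mul_left_cancel₀ (pow_ne_zero 2 hne)
    linear_combination 2 * u * v * hquad + (u ^ 2 - v ^ 2) * (hm0 - hm) - 2 * u * v * (hn0 - hn)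
  subst ha hb hc
  have hd : d = 0 := by linarith
  have he : e = 0 := by linarith
  subst hd he
  exact ⟨rfl, rfl, rfl, rfl, rfl, by linarith⟩

lemma signedArea_ne_zero_of_noThreeCollinear {A B C P Z : ℂ}
    (h : NoThreeCollinear [A, B, C, P, Z]) :
    signedArea A B C ≠ 0 ∧ signedArea P Z A ≠ 0 ∧ signedArea P Z B ≠ 0 ∧
      signedArea P Z C ≠ 0 := by
  have key : ∀ i j k : Fin 5, i ≠ j → i ≠ k → j ≠ k →
      signedArea ([A, B, C, P, Z].get i) ([A, B, C, P, Z].get j) ([A, B, C, P, Z].get k) ≠ 0 :=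
    fun i j k hij hik hjk h0 => h i j k hij hik hjk (collinear_of_signedArea_eq_zero h0)
  exact ⟨key 0 1 2 (by decide) (by decide) (by decide),
    key 3 4 0 (by decide) (by decide) (by decide),
    key 3 4 1 (by decide) (by decide) (by decide),
    key 3 4 2 (by decide) (by decide) (by decide)⟩

/-- A conic through five points, no three collinear, has a unique equation up to scaling. -/
lemma conic_coeffs_proportional {a b c d e f a' b' c' d' e' f' : ℝ} {A B C P Z : ℂ}
    (hne : ¬(a = 0 ∧ b = 0 ∧ c = 0 ∧ d = 0 ∧ e = 0 ∧ f = 0))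
    (hA : conicEval a b c d e f A = 0) (hB : conicEval a b c d e f B = 0)
    (hC : conicEval a b c d e f C = 0) (hP : conicEval a b c d e f P = 0)
    (hZ : conicEval a b c d e f Z = 0)
    (hA' : conicEval a' b' c' d' e' f' A = 0) (hB' : conicEval a' b' c' d' e' f' B = 0)
    (hC' : conicEval a' b' c' d' e' f' C = 0) (hP' : conicEval a' b' c' d' e' f' P = 0)
    (hZ' : conicEval a' b' c' d' e' f' Z = 0)
    (h5 : NoThreeCollinear [A, B, C, P, Z]) :
    ∃ k : ℝ, a' = k * a ∧ b' = k * b ∧ c' = k * c ∧ d' = k * d ∧ e' = k * e ∧ f' = k * f := by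
  obtain ⟨hABC, hPZA, hPZB, hPZC⟩ := signedArea_ne_zero_of_noThreeCollinear h5
  obtain ⟨M, hM⟩ : ∃ M, M = (P + Z) / 2 := ⟨_, rfl⟩
  obtain ⟨s, hs⟩ : ∃ s, s = conicEval a b c d e f M := ⟨_, rfl⟩
  obtain ⟨s', hs'⟩ : ∃ s', s' = conicEval a' b' c' d' e' f' M := ⟨_, rfl⟩
  have hs0 : s ≠ 0 := by
    intro h0
    rw [h0, hM] at hs
    exact hne (conic_coeffs_eq_zero hA hB hC hP hZ hs.symm hABC hPZA hPZB hPZC)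
  have hcomb : ∀ z, conicEval (s * a' - s' * a) (s * b' - s' * b) (s * c' - s' * c)
      (s * d' - s' * d) (s * e' - s' * e) (s * f' - s' * f) z =
      s * conicEval a' b' c' d' e' f' z - s' * conicEval a b c d e f z := by
    intro z
    unfold conicEval
    ring
  obtain ⟨h1, h2, h3, h4, h5, h6⟩ := conic_coeffs_eq_zero (P := P) (Z := Z)
    (by rw [hcomb, hA, hA']; ring) (by rw [hcomb, hB, hB']; ring)
    (by rw [hcomb, hC, hC']; ring) (by rw [hcomb, hP, hP']; ring)
    (by rw [hcomb, hZ, hZ']; ring) (by rw [hcomb, ← hM, ← hs, ← hs']; ring)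
    hABC hPZA hPZB hPZC
  refine ⟨s' / s, ?_, ?_, ?_, ?_, ?_, ?_⟩ <;> field_simp <;> linarith

lemma vertex_identity {a b c d p p' q q' : ℂ} (ha : a ≠ 0) (hb : b ≠ 0) (hc : c ≠ 0)
    (h1 : p + p' + a * b * c * (q * q') = a + b + c)
    (h2 : p * p' + a * b * c * (q + q') = a * b + b * c + c * a)
    (h3 : d * (p - p') + a * b * c * (q - q') = 0) :
    b * c * ((a * (d * q - 1) - (d - p)) * (a * (d * q' - 1) - (d - p'))) =
      (d * (a - p) + b * c - a * b * c * q) ^ 2 := by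
  obtain ⟨t, ht⟩ : ∃ t, t = a * b * c := ⟨_, rfl⟩
  obtain ⟨U, hU⟩ : ∃ U, U = d * p + t * q := ⟨_, rfl⟩
  have ht0 : t ≠ 0 := by rw [ht]; exact mul_ne_zero (mul_ne_zero ha hb) hc
  rw [← ht] at h1 h2 h3
  have hU' : U = d * p' + t * q' := by linear_combination hU + h3
  have hq : t * q = U - d * p := by linear_combination -hU
  have hq' : t * q' = U - d * p' := by linear_combination -hU'
  have r1 : t * (p + p') + (U - d * p) * (U - d * p') = t * (a + b + c) := by
    rw [← hq, ← hq']; linear_combination t * h1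
  have r2 : p * p' + 2 * U - d * (p + p') = a * b + b * c + c * a := by
    linear_combination h2 - hq - hq'
  have e1 : t * (a * (d * q - 1) - (d - p)) = (a * d * U - a * t - d * t) + p * (t - a * d ^ 2) := by
    linear_combination a * d * hq
  have e2 : t * (a * (d * q' - 1) - (d - p')) =
      (a * d * U - a * t - d * t) + p' * (t - a * d ^ 2) := by
    linear_combination a * d * hq'
  apply mul_left_cancel₀ (mul_ne_zero ht0 ht0)
  calc _ = b * c * ((t * (a * (d * q - 1) - (d - p))) * (t * (a * (d * q' - 1) - (d - p')))) := by
        ring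
    _ = t * t * (d * a + b * c - U) ^ 2 := by
        rw [e1, e2]
        have hN : ((a * d * U - a * t - d * t) + p * (t - a * d ^ 2)) *
            ((a * d * U - a * t - d * t) + p' * (t - a * d ^ 2)) =
            (a * d * U - a * t - d * t) ^ 2 +
            (a * b + b * c + c * a - 2 * U) * (t - a * d ^ 2) ^ 2 -
            a * (t - a * d ^ 2) * (t * (a + b + c) - U ^ 2
              - d ^ 2 * (a * b + b * c + c * a) + 2 * d ^ 2 * U) := by
          linear_combination ((t - a * d ^ 2) ^ 2 + a * (t - a * d ^ 2) * d ^ 2) * r2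
            - a * (t - a * d ^ 2) * r1
        rw [hN, ht]; ring
    _ = _ := by rw [← ht, hU]; ring

lemma mul_conj_eq_of_div_im_eq_zero {u v : ℂ} (hv : v ≠ 0) (h : (u / v).im = 0) :
    u * conj v = conj u * v := by
  have h1 := Complex.conj_eq_iff_im.2 h
  rw [map_div₀, div_eq_div_iff (by simpa using hv) hv] at h1
  exact h1.symm

/-- The isogonality condition at the vertex `a` of a triangle inscribed in the unit circle. -/
lemma isogonal_at_vertex {a b c p p' : ℂ} (ha : a * conj a = 1) (hb : b * conj b = 1)
    (hc : c * conj c = 1) (hab : a ≠ b) (hac : a ≠ c)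
    (h : ((p - a) * (p' - a) / ((b - a) * (c - a))).im = 0) :
    (p - a) * (p' - a) = b * c * ((a * conj p - 1) * (a * conj p' - 1)) := by
  have hba := sub_ne_zero.2 hab.symm
  have hca := sub_ne_zero.2 hac.symm
  have h1 := mul_conj_eq_of_div_im_eq_zero (mul_ne_zero hba hca) h
  simp only [map_mul, map_sub] at h1
  have eb : a * b * (conj b - conj a) = -(b - a) := by linear_combination a * hb - b * ha
  have ec : a * c * (conj c - conj a) = -(c - a) := by linear_combination a * hc - c * ha
  have ep : a * (conj p - conj a) = a * conj p - 1 := by linear_combination -ha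
  have ep' : a * (conj p' - conj a) = a * conj p' - 1 := by linear_combination -ha
  apply mul_right_cancel₀ (mul_ne_zero hba hca)
  calc _ = (p - a) * (p' - a) * (-(b - a) * -(c - a)) := by ring
    _ = b * c * ((a * (conj p - conj a)) * (a * (conj p' - conj a))) * ((b - a) * (c - a)) := by
      rw [← eb, ← ec]
      linear_combination a ^ 2 * b * c * h1
    _ = _ := by rw [ep, ep']

/-- Isogonal conjugates with respect to a triangle inscribed in the unit circle. -/
lemma isogonal_relations {a b c p p' : ℂ} (ha : a * conj a = 1) (hb : b * conj b = 1)
    (hc : c * conj c = 1) (hab : a ≠ b) (hac : a ≠ c) (hbc : b ≠ c)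
    (h : IsogConj a b c p p') :
    p + p' + a * b * c * (conj p * conj p') = a + b + c ∧
    p * p' + a * b * c * (conj p + conj p') = a * b + b * c + c * a := by
  have h1 := isogonal_at_vertex ha hb hc hab hac h.1
  have h2 := isogonal_at_vertex hb hc ha hbc hab.symm h.2.1
  have h3 : p + p' + a * b * c * (conj p * conj p') = a + b + c := by
    apply mul_left_cancel₀ (sub_ne_zero.2 hab)
    linear_combination h2 - h1
  exact ⟨h3, by linear_combination h1 + a * h3⟩

/-- The second intersection of the line `dp` with the unit circle. -/
lemma second_intersection {d p x : ℂ} (hd : d * conj d = 1) (hx : x * conj x = 1) (hxd : x ≠ d)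
    {t : ℝ} (h : x = d + t * (p - d)) : x * (d * conj p - 1) = d - p := by
  have h' : conj x = conj d + t * (conj p - conj d) := by
    rw [h]; simp
  apply mul_left_cancel₀ (sub_ne_zero.2 hxd)
  have e1 : d * x * (conj x - conj d) = d - x := by linear_combination d * hx - x * hd
  have e2 : d * (conj p - conj d) = d * conj p - 1 := by linear_combination -hd
  rw [← e2]
  linear_combination x * d * (conj p - conj d) * h - d * x * (p - d) * h' + (p - d) * e1

lemma mul_conj_sub_one_ne_zero {d p : ℂ} (hd : d * conj d = 1) (hdp : d ≠ p) :
    d * conj p - 1 ≠ 0 := by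
  intro h
  have hd0 : d ≠ 0 := left_ne_zero_of_mul_eq_one hd
  have h1 : conj p = conj d := mul_left_cancel₀ hd0 (by linear_combination h - hd)
  exact hdp ((starRingEnd ℂ).injective h1).symm

/-- The power of a point `a` of the unit circle with respect to a circle meeting the unit circle
at `x ≠ y`. -/
lemma power_of_point {a x y o ρ : ℂ} (ha : a * conj a = 1) (hx : x * conj x = 1)
    (hy : y * conj y = 1) (hxy : x ≠ y)
    (hxo : (x - o) * conj (x - o) - ρ = 0) (hyo : (y - o) * conj (y - o) - ρ = 0) :
    a * ((a - o) * conj (a - o) - ρ) = -(conj o * ((a - x) * (a - y))) := by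
  simp only [map_sub] at *
  obtain ⟨m, hm⟩ : ∃ m, m = 1 + o * conj o - ρ := ⟨_, rfl⟩
  have ex : m * x - conj o * x ^ 2 - o = 0 := by
    rw [hm]; linear_combination x * hxo - (x - o) * hx
  have ey : m * y - conj o * y ^ 2 - o = 0 := by
    rw [hm]; linear_combination y * hyo - (y - o) * hy
  have hsum : m = conj o * (x + y) := by
    apply mul_left_cancel₀ (sub_ne_zero.2 hxy)
    linear_combination ex - ey
  linear_combination (a - o) * ha - a * hm + (a - x) * hsum + ex

/-- The ratio between the power of a vertex with respect to the circle `γ` and the square of its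
distance from the line `pp'`. -/
lemma power_eq_line_sq {a b c d p p' x y o ρ : ℂ} (ha : a * conj a = 1) (hb : b * conj b = 1)
    (hc : c * conj c = 1) (hx : x * conj x = 1) (hy : y * conj y = 1) (hxy : x ≠ y)
    (h1 : p + p' + a * b * c * (conj p * conj p') = a + b + c)
    (h2 : p * p' + a * b * c * (conj p + conj p') = a * b + b * c + c * a)
    (h3 : d * (p - p') + a * b * c * (conj p - conj p') = 0)
    (hxd : x * (d * conj p - 1) = d - p) (hyd : y * (d * conj p' - 1) = d - p')
    (hxo : (x - o) * conj (x - o) - ρ = 0) (hyo : (y - o) * conj (y - o) - ρ = 0) :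
    ((a - o) * conj (a - o) - ρ) * (a * b * c * ((d * conj p - 1) * (d * conj p' - 1)) *
      conj (p' - p) ^ 2) =
    -(conj o * d ^ 2) * (conj (p' - p) * (a - p) - (p' - p) * conj (a - p)) ^ 2 := by
  have ha0 := left_ne_zero_of_mul_eq_one ha
  have hv := vertex_identity ha0 (left_ne_zero_of_mul_eq_one hb)
    (left_ne_zero_of_mul_eq_one hc) h1 h2 h3
  have hp := power_of_point ha hx hy hxy hxo hyo
  have hl : conj (p' - p) * (d * (a - p) + b * c - a * b * c * conj p) =
      d * (conj (p' - p) * (a - p) - (p' - p) * conj (a - p)) := by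
    simp only [map_sub]
    linear_combination (conj p - conj a) * h3 - b * c * (conj p' - conj p) * ha
  calc _ = b * c * ((d * conj p - 1) * (d * conj p' - 1)) * conj (p' - p) ^ 2 *
        (a * ((a - o) * conj (a - o) - ρ)) := by ring
    _ = -(conj o) * conj (p' - p) ^ 2 * (b * c *
        ((a * (d * conj p - 1) - x * (d * conj p - 1)) *
          (a * (d * conj p' - 1) - y * (d * conj p' - 1)))) := by
      rw [hp]; ring
    _ = -(conj o) * (conj (p' - p) * (d * (a - p) + b * c - a * b * c * conj p)) ^ 2 := by
      rw [hxd, hyd, hv]; ring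
    _ = _ := by rw [hl]; ring

/-- The power of a vertex with respect to `γ` is proportional to the squared distance of the
vertex from the line `pp'`. -/
lemma power_mul_line_sq {a b c d p p' x y o ρ : ℂ} (ha : a * conj a = 1) (hb : b * conj b = 1)
    (hc : c * conj c = 1) (hd : d * conj d = 1) (hx : x * conj x = 1) (hy : y * conj y = 1)
    (hxy : x ≠ y) (hpp' : p ≠ p') (hdp : d ≠ p) (hdp' : d ≠ p')
    (h1 : p + p' + a * b * c * (conj p * conj p') = a + b + c)
    (h2 : p * p' + a * b * c * (conj p + conj p') = a * b + b * c + c * a)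
    (h3 : d * (p - p') + a * b * c * (conj p - conj p') = 0)
    (hxd : x * (d * conj p - 1) = d - p) (hyd : y * (d * conj p' - 1) = d - p')
    (hxo : (x - o) * conj (x - o) - ρ = 0) (hyo : (y - o) * conj (y - o) - ρ = 0) :
    ((a - o) * conj (a - o) - ρ) * (conj (p' - p) * (b - p) - (p' - p) * conj (b - p)) ^ 2 =
    ((b - o) * conj (b - o) - ρ) * (conj (p' - p) * (a - p) - (p' - p) * conj (a - p)) ^ 2 := by
  have e1 := power_eq_line_sq ha hb hc hx hy hxy h1 h2 h3 hxd hyd hxo hyo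
  have e2 := power_eq_line_sq hb ha hc hx hy hxy (by linear_combination h1)
    (by linear_combination h2) (by linear_combination h3) hxd hyd hxo hyo
  have hv : conj (p' - p) ≠ 0 := (map_ne_zero _).2 (sub_ne_zero.2 hpp'.symm)
  have hk : a * b * c * ((d * conj p - 1) * (d * conj p' - 1)) * conj (p' - p) ^ 2 ≠ 0 :=
    mul_ne_zero (mul_ne_zero (mul_ne_zero (mul_ne_zero (left_ne_zero_of_mul_eq_one ha)
      (left_ne_zero_of_mul_eq_one hb)) (left_ne_zero_of_mul_eq_one hc))
      (mul_ne_zero (mul_conj_sub_one_ne_zero hd hdp) (mul_conj_sub_one_ne_zero hd hdp')))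
      (pow_ne_zero 2 hv)
  apply mul_left_cancel₀ hk
  linear_combination (conj (p' - p) * (b - p) - (p' - p) * conj (b - p)) ^ 2 * e1 -
    (conj (p' - p) * (a - p) - (p' - p) * conj (a - p)) ^ 2 * e2

lemma exists_conicEval_comp (a b c d e f : ℝ) (O : ℂ) {r : ℝ} (hr : r ≠ 0) :
    ∃ a' b' c' d' e' f' : ℝ, ∀ w : ℂ,
      conicEval a' b' c' d' e' f' (O + r * w) = conicEval a b c d e f w := by
  refine ⟨a / r ^ 2, b / r ^ 2, c / r ^ 2, d / r - 2 * a * O.re / r ^ 2 - b * O.im / r ^ 2,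
    e / r - 2 * c * O.im / r ^ 2 - b * O.re / r ^ 2,
    f - d * O.re / r - e * O.im / r + a * O.re ^ 2 / r ^ 2 + b * O.re * O.im / r ^ 2 +
      c * O.im ^ 2 / r ^ 2, fun w => ?_⟩
  simp only [conicEval, Complex.add_re, Complex.add_im, Complex.re_ofReal_mul,
    Complex.im_ofReal_mul]
  field_simp
  ring

lemma exists_conicEval_eq_im (α β γ ε : ℂ) (κ : ℝ) :
    ∃ a b c d e f : ℝ, ∀ w : ℂ, conicEval a b c d e f w =
      (α * w + β * conj w + γ * conj w ^ 2 + ε).im + κ * (Complex.normSq w - 1) := by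
  refine ⟨γ.im + κ, -2 * γ.re, -γ.im + κ, α.im + β.im, α.re - β.re, ε.im - κ, fun w => ?_⟩
  simp only [conicEval, pow_two, Complex.add_im, Complex.mul_im, Complex.mul_re, Complex.conj_re,
    Complex.conj_im, Complex.normSq_apply]
  ring

/-- The fourth intersection `d` of the unit circle with the conic through `a, b, c, p, p'`, where
`p` and `p'` are isogonal conjugates: the isogonal conjugate of `d` is the point at infinity of
the line `pp'`. -/
lemma fourth_intersection {a b c d p p' O : ℂ} {r : ℝ} (hr : r ≠ 0)
    (ha : a * conj a = 1) (hb : b * conj b = 1) (hc : c * conj c = 1) (hd : d * conj d = 1)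
    (hda : d ≠ a) (hdb : d ≠ b) (hdc : d ≠ c)
    (h1 : p + p' + a * b * c * (conj p * conj p') = a + b + c)
    (h2 : p * p' + a * b * c * (conj p + conj p') = a * b + b * c + c * a)
    (h5 : NoThreeCollinear [O + r * a, O + r * b, O + r * c, O + r * p, O + r * p'])
    {H : Set ℂ} (hH : IsConic H) (haH : O + r * a ∈ H) (hbH : O + r * b ∈ H)
    (hcH : O + r * c ∈ H) (hpH : O + r * p ∈ H) (hp'H : O + r * p' ∈ H) (hdH : O + r * d ∈ H) :
    d * (p - p') + a * b * c * (conj p - conj p') = 0 := by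
  obtain ⟨f₁, f₂, f₃, f₄, f₅, f₆, hf, rfl⟩ := hH
  simp only [Set.mem_ofPred_eq] at haH hbH hcH hpH hp'H hdH
  obtain ⟨Q, hQ⟩ : ∃ Q : ℂ → ℂ, ∀ w, Q w = w - (a + b + c) + (a * b + b * c + c * a) * conj w -
    a * b * c * conj w ^ 2 := ⟨_, fun _ => rfl⟩
  obtain ⟨k₁, k₂, k₃, k₄, k₅, k₆, hk⟩ : ∃ k₁ k₂ k₃ k₄ k₅ k₆ : ℝ, ∀ w : ℂ,
      conicEval k₁ k₂ k₃ k₄ k₅ k₆ (O + r * w) = (conj (p' - p) * Q w).im +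
        -(conj (p' - p) * p).im * (Complex.normSq w - 1) := by
    obtain ⟨m₁, m₂, m₃, m₄, m₅, m₆, hm⟩ := exists_conicEval_eq_im (conj (p' - p))
      (conj (p' - p) * (a * b + b * c + c * a)) (-(conj (p' - p) * (a * b * c)))
      (-(conj (p' - p) * (a + b + c))) (-(conj (p' - p) * p).im)
    obtain ⟨n₁, n₂, n₃, n₄, n₅, n₆, hn⟩ := exists_conicEval_comp m₁ m₂ m₃ m₄ m₅ m₆ O hr
    refine ⟨n₁, n₂, n₃, n₄, n₅, n₆, fun w => ?_⟩
    rw [hn, hm, hQ]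
    congr 2
    ring
  have hnorm : ∀ w : ℂ, w * conj w = 1 → Complex.normSq w = 1 := by
    intro w hw
    rw [Complex.mul_conj] at hw
    exact_mod_cast hw
  have hQa : Q a = 0 := by rw [hQ]; linear_combination (b + c - b * c * conj a) * ha
  have hQb : Q b = 0 := by rw [hQ]; linear_combination (a + c - a * c * conj b) * hb
  have hQc : Q c = 0 := by rw [hQ]; linear_combination (a + b - a * b * conj c) * hc
  have hQp : Q p = p' * ((Complex.normSq p - 1 : ℝ) : ℂ) := by
    rw [hQ, Complex.ofReal_sub, ← Complex.mul_conj, Complex.ofReal_one]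
    linear_combination h1 - conj p * h2
  have hQp' : Q p' = p * ((Complex.normSq p' - 1 : ℝ) : ℂ) := by
    rw [hQ, Complex.ofReal_sub, ← Complex.mul_conj, Complex.ofReal_one]
    linear_combination h1 - conj p' * h2
  have him : (conj (p' - p) * p').im = (conj (p' - p) * p).im := by
    simp only [Complex.mul_im, Complex.conj_re, Complex.conj_im, Complex.sub_re, Complex.sub_im]
    ring
  obtain ⟨k, e₁, e₂, e₃, e₄, e₅, e₆⟩ := conic_coeffs_proportional hf haH hbH hcH hpH hp'H
    (by rw [hk, hQa, hnorm a ha]; simp) (by rw [hk, hQb, hnorm b hb]; simp)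
    (by rw [hk, hQc, hnorm c hc]; simp)
    (by rw [hk, hQp, ← mul_assoc, Complex.im_mul_ofReal, him, neg_mul, add_neg_cancel])
    (by rw [hk, hQp', ← mul_assoc, Complex.im_mul_ofReal, neg_mul, add_neg_cancel]) h5
  have hQd : (conj (p' - p) * Q d).im = 0 := by
    have h := hk d
    rw [hnorm d hd, sub_self, mul_zero, add_zero] at h
    rw [← h, e₁, e₂, e₃, e₄, e₅, e₆]
    unfold conicEval at hdH ⊢
    linear_combination k * hdH
  rw [← Complex.conj_eq_iff_im, hQ] at hQd
  simp only [map_mul, map_sub, map_add, map_pow, Complex.conj_conj] at hQd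
  have s1 : a * b * c * d * (conj d - (conj a + conj b + conj c) + (conj a * conj b +
      conj b * conj c + conj c * conj a) * d - conj a * conj b * conj c * d ^ 2) =
      -((d - a) * (d - b) * (d - c)) := by
    have hab : a * b * (conj a * conj b) = 1 := by linear_combination b * conj b * ha + hb
    have hbc : b * c * (conj b * conj c) = 1 := by linear_combination c * conj c * hb + hc
    have hca : c * a * (conj c * conj a) = 1 := by linear_combination a * conj a * hc + ha
    have habc : a * b * c * (conj a * conj b * conj c) = 1 := by
      linear_combination c * conj c * hab + hc
    linear_combination a * b * c * hd - b * c * d * ha - a * c * d * hb - a * b * d * hc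
      + d ^ 2 * (c * hab + a * hbc + b * hca) - d ^ 3 * habc
  have s2 : d ^ 2 * (d - (a + b + c) + (a * b + b * c + c * a) * conj d -
      a * b * c * conj d ^ 2) = (d - a) * (d - b) * (d - c) := by
    linear_combination ((a * b + b * c + c * a) * d - a * b * c * (d * conj d + 1)) * hd
  apply mul_left_cancel₀ (mul_ne_zero (mul_ne_zero (sub_ne_zero.2 hda) (sub_ne_zero.2 hdb))
    (sub_ne_zero.2 hdc))
  linear_combination a * b * c * d ^ 2 * hQd - d * (p' - p) * s1 +
    a * b * c * (conj p' - conj p) * s2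

lemma perpLineAt_ofReal_mul (W g : ℂ) {k : ℝ} (hk : k ≠ 0) :
    perpLineAt W (k * g) = perpLineAt W g := by
  ext w
  simp only [perpLineAt, Set.mem_ofPred_eq, Complex.re_ofReal_mul, Complex.im_ofReal_mul]
  constructor
  · intro h
    apply mul_left_cancel₀ hk
    linear_combination h
  · intro h
    linear_combination k * h

lemma exists_conicEval_pencil (l m : ℝ) (P P' O : ℂ) (r : ℝ) :
    ∃ a b c d e f : ℝ,
      (∀ w, conicEval a b c d e f w =
        l * (Complex.normSq (w - O) - r ^ 2) - m * signedArea P P' w ^ 2) ∧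
      ∀ w, signedArea P P' w = 0 →
        conicGrad a b c d e f w = ((2 * l : ℝ) : ℂ) * (w - O) := by
  obtain ⟨u, hu⟩ : ∃ u, u = P'.re - P.re := ⟨_, rfl⟩
  obtain ⟨v, hv⟩ : ∃ v, v = P'.im - P.im := ⟨_, rfl⟩
  obtain ⟨n, hn⟩ : ∃ n, n = v * P.re - u * P.im := ⟨_, rfl⟩
  have hs : ∀ w, signedArea P P' w = u * w.im - v * w.re + n := by
    intro w
    rw [signedArea, hn, hu, hv]
    ring
  refine ⟨l - m * v ^ 2, 2 * m * u * v, l - m * u ^ 2, -2 * l * O.re + 2 * m * v * n,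
    -2 * l * O.im - 2 * m * u * n, l * (O.re ^ 2 + O.im ^ 2 - r ^ 2) - m * n ^ 2,
    fun w => ?_, fun w hw => ?_⟩
  · rw [hs]
    simp only [conicEval, Complex.normSq_apply, Complex.sub_re, Complex.sub_im]
    ring
  · rw [hs] at hw
    apply Complex.ext
    · simp only [conicGrad, Complex.add_re, Complex.ofReal_re, Complex.re_ofReal_mul,
        Complex.I_re, Complex.sub_re]
      linear_combination 2 * m * v * hw
    · simp only [conicGrad, Complex.add_im, Complex.ofReal_im, Complex.im_ofReal_mul,
        Complex.I_im, Complex.sub_im]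
      linear_combination -2 * m * u * hw

lemma circleConicTangentAt_of_pencil {a b c d e f a' b' c' d' e' f' k l r : ℝ} {O W : ℂ}
    (hr : 0 < r) (hl : l ≠ 0) (hne : ¬(a = 0 ∧ b = 0 ∧ c = 0 ∧ d = 0 ∧ e = 0 ∧ f = 0))
    (hWγ : W ∈ circleSet O r) (hW : conicEval a b c d e f W = 0)
    (hgrad : conicGrad a' b' c' d' e' f' W = ((2 * l : ℝ) : ℂ) * (W - O))
    (ha : a' = k * a) (hb : b' = k * b) (hc : c' = k * c) (hd : d' = k * d) (he : e' = k * e) :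
    CircleConicTangentAt O r {z | conicEval a b c d e f z = 0} W := by
  have hWO : W - O ≠ 0 := by
    rw [circleSet, Set.mem_ofPred_eq] at hWγ
    exact norm_ne_zero_iff.1 (by linarith)
  have hscale : conicGrad a' b' c' d' e' f' W = (k : ℂ) * conicGrad a b c d e f W := by
    rw [ha, hb, hc, hd, he]
    simp only [conicGrad]
    push_cast
    ring
  have h2l : ((2 * l : ℝ) : ℂ) * (W - O) ≠ 0 :=
    mul_ne_zero (by exact_mod_cast mul_ne_zero two_ne_zero hl) hWO
  have hk : (k : ℂ) * conicGrad a b c d e f W ≠ 0 := by rwa [← hscale, hgrad]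
  refine ⟨hWγ, hW, a, b, c, d, e, f, hne, rfl, hW, right_ne_zero_of_mul hk, ?_⟩
  have hk0 : k ≠ 0 := by exact_mod_cast left_ne_zero_of_mul hk
  rw [← perpLineAt_ofReal_mul W (conicGrad a b c d e f W) hk0, ← hscale, hgrad,
    perpLineAt_ofReal_mul W _ (mul_ne_zero two_ne_zero hl)]

theorem statement5
    (A B C O : ℂ) (r : ℝ) (Ω : Set ℂ)
    (hr : 0 < r) (hΩ : Ω = circleSet O r)
    (hAΩ : A ∈ Ω) (hBΩ : B ∈ Ω) (hCΩ : C ∈ Ω)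
    (hABC : ¬ Collinear ℝ ({A, B, C} : Set ℂ))
    (P P' : ℂ) (hPP' : P ≠ P') (hconj : IsogConj A B C P P')
    (h5 : NoThreeCollinear [A, B, C, P, P'])
    (H : Set ℂ) (hH : IsConic H)
    (hAH : A ∈ H) (hBH : B ∈ H) (hCH : C ∈ H) (hPH : P ∈ H) (hP'H : P' ∈ H)
    (D : ℂ) (hDΩ : D ∈ Ω) (hDH : D ∈ H) (hDA : D ≠ A) (hDB : D ≠ B) (hDC : D ≠ C)
    (hDP : D ≠ P) (hDP' : D ≠ P')
    (X : ℂ) (hXD : X ≠ D) (hXΩ : X ∈ Ω) (hXline : X ∈ lineThrough D P)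
    (Y : ℂ) (hYD : Y ≠ D) (hYΩ : Y ∈ Ω) (hYline : Y ∈ lineThrough D P')
    (hPXY : ¬ Collinear ℝ ({P, X, Y} : Set ℂ))
    (O₁ : ℂ) (r₁ : ℝ) (hr₁ : 0 < r₁)
    (hPγ : P ∈ circleSet O₁ r₁) (hXγ : X ∈ circleSet O₁ r₁) (hYγ : Y ∈ circleSet O₁ r₁)
    (Z : ℂ) (hZP : Z ≠ P) (hZγ : Z ∈ circleSet O₁ r₁) (hZline : Z ∈ lineThrough P P')
    (h5Z : NoThreeCollinear [A, B, C, P, Z])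
    (E : Set ℂ) (hE : IsConic E)
    (hAE : A ∈ E) (hBE : B ∈ E) (hCE : C ∈ E) (hPE : P ∈ E) (hZE : Z ∈ E) :
    CircleConicTangentAt O₁ r₁ E P ∧ CircleConicTangentAt O₁ r₁ E Z := by
  have hrC : (r : ℂ) ≠ 0 := by exact_mod_cast hr.ne'
  have hnormalize : ∀ W : ℂ, ∃ w, W = O + r * w := fun W =>
    ⟨(W - O) / r, by field_simp; ring⟩
  have hinj : ∀ {u w : ℂ}, O + r * u ≠ O + r * w → u ≠ w := fun h huw => h (by rw [huw])
  have hunit : ∀ w : ℂ, O + r * w ∈ Ω → w * conj w = 1 := by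
    intro w hw
    rw [hΩ, circleSet, Set.mem_ofPred_eq, add_sub_cancel_left, norm_mul, Complex.norm_real,
      Real.norm_of_nonneg hr.le] at hw
    rw [Complex.mul_conj', mul_left_cancel₀ hr.ne' (hw.trans (mul_one r).symm)]
    simp
  have hABC' : ∀ {u v w : ℂ}, ({u, v, w} : Set ℂ) = {A, B, C} → v ≠ w := by
    rintro u v w h rfl
    rw [← h, Set.pair_eq_singleton] at hABC
    exact hABC (collinear_pair ℝ u v)
  have hAB : A ≠ B := hABC' (u := C) (by grind)
  have hAC : A ≠ C := hABC' (u := B) (by grind)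
  have hBC : B ≠ C := hABC' (u := A) rfl
  have hXY : X ≠ Y := by
    rintro rfl
    rw [Set.pair_eq_singleton] at hPXY
    exact hPXY (collinear_pair ℝ P X)
  have hLA : signedArea P P' A ≠ 0 := (signedArea_ne_zero_of_noThreeCollinear h5).2.1
  have hγ : ∀ W ∈ circleSet O₁ r₁, Complex.normSq (W - O₁) - r₁ ^ 2 = 0 := by
    intro W hW
    rw [circleSet, Set.mem_ofPred_eq] at hW
    rw [Complex.normSq_eq_norm_sq, hW, sub_self]
  -- The power with respect to `γ` is proportional to the squared distance from `PP'`.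
  have hpower : ∀ W ∈ ({B, C} : Set ℂ),
      signedArea P P' A ^ 2 * (Complex.normSq (W - O₁) - r₁ ^ 2) -
        (Complex.normSq (A - O₁) - r₁ ^ 2) * signedArea P P' W ^ 2 = 0 := by
    have hXγ' := hγ X hXγ
    have hYγ' := hγ Y hYγ
    clear hγ hLA hABC' hZγ hZline h5Z hAE hBE hCE hPE hZE
    obtain ⟨tx, htx⟩ := hXline
    obtain ⟨ty, hty⟩ := hYline
    obtain ⟨a, rfl⟩ := hnormalize A
    obtain ⟨b, rfl⟩ := hnormalize B
    obtain ⟨c, rfl⟩ := hnormalize C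
    obtain ⟨p, rfl⟩ := hnormalize P
    obtain ⟨p', rfl⟩ := hnormalize P'
    obtain ⟨d, rfl⟩ := hnormalize D
    obtain ⟨x, rfl⟩ := hnormalize X
    obtain ⟨y, rfl⟩ := hnormalize Y
    obtain ⟨o, rfl⟩ := hnormalize O₁
    have ha := hunit a hAΩ
    have hb := hunit b hBΩ
    have hc := hunit c hCΩ
    have hd := hunit d hDΩ
    have hx := hunit x hXΩ
    have hy := hunit y hYΩ
    have hsub : ∀ u w : ℂ, O + r * u - (O + r * w) = r * (u - w) := fun u w => by ring
    have hconj' : IsogConj a b c p p' := by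
      have hratio : ∀ u w u' w' : ℂ, r * u * (r * w) / (r * u' * (r * w')) = u * w / (u' * w') := by
        intro u w u' w'
        rw [mul_mul_mul_comm, mul_mul_mul_comm (r : ℂ) u', mul_div_mul_left _ _ (mul_ne_zero hrC hrC)]
      simpa only [IsogConj, hsub, hratio] using hconj
    obtain ⟨h1, h2⟩ := isogonal_relations ha hb hc (hinj hAB) (hinj hAC) (hinj hBC) hconj'
    have h3 := fourth_intersection hr.ne' ha hb hc hd (hinj hDA) (hinj hDB) (hinj hDC) h1 h2 h5
      hH hAH hBH hCH hPH hP'H hDH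
    have hline : ∀ {u w : ℂ} {t : ℝ},
        O + r * u = O + r * d + t • (O + r * w - (O + r * d)) → u = d + t * (w - d) := by
      intro u w t h
      rw [hsub, Complex.real_smul] at h
      apply mul_left_cancel₀ hrC
      linear_combination h
    have hxd := second_intersection hd hx (hinj hXD) (hline htx)
    have hyd := second_intersection hd hy (hinj hYD) (hline hty)
    have hpow : ∀ w : ℂ, ((Complex.normSq (O + r * w - (O + r * o)) - r₁ ^ 2 : ℝ) : ℂ) =
        r ^ 2 * ((w - o) * conj (w - o) - (r₁ / r) ^ 2) := by
      intro w
      rw [hsub, Complex.normSq_mul, Complex.normSq_ofReal, Complex.mul_conj]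
      push_cast
      field_simp
    have harea : ∀ w : ℂ, ((signedArea (O + r * p) (O + r * p') (O + r * w) : ℝ) : ℂ) *
        (2 * Complex.I) = r ^ 2 * (conj (p' - p) * (w - p) - (p' - p) * conj (w - p)) := by
      intro w
      apply Complex.ext <;> simp [signedArea, pow_two, -zero_eq_mul, -mul_eq_zero] <;> ring
    have hcircle : ∀ {w : ℂ}, Complex.normSq (O + r * w - (O + r * o)) - r₁ ^ 2 = 0 →
        (w - o) * conj (w - o) - ((r₁ : ℂ) / r) ^ 2 = 0 := by
      intro w hw
      apply mul_left_cancel₀ (pow_ne_zero 2 hrC)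
      rw [← hpow, hw]
      simp
    have hkey : ∀ w : ℂ, ((a - o) * conj (a - o) - ((r₁ : ℂ) / r) ^ 2) *
          (conj (p' - p) * (w - p) - (p' - p) * conj (w - p)) ^ 2 =
        ((w - o) * conj (w - o) - ((r₁ : ℂ) / r) ^ 2) *
          (conj (p' - p) * (a - p) - (p' - p) * conj (a - p)) ^ 2 →
        signedArea (O + r * p) (O + r * p') (O + r * a) ^ 2 *
          (Complex.normSq (O + r * w - (O + r * o)) - r₁ ^ 2) -
        (Complex.normSq (O + r * a - (O + r * o)) - r₁ ^ 2) *
          signedArea (O + r * p) (O + r * p') (O + r * w) ^ 2 = 0 := by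
      intro w hw
      have hI : (2 * Complex.I) ^ 2 ≠ 0 := pow_ne_zero 2 (mul_ne_zero two_ne_zero Complex.I_ne_zero)
      apply Complex.ofReal_injective
      apply mul_right_cancel₀ hI
      rw [Complex.ofReal_sub, Complex.ofReal_mul, Complex.ofReal_mul, hpow, hpow,
        Complex.ofReal_pow, Complex.ofReal_pow, Complex.ofReal_zero, zero_mul, sub_mul,
        mul_right_comm, ← mul_pow, mul_assoc _ _ ((2 * Complex.I) ^ 2), ← mul_pow, harea, harea]
      linear_combination -(r : ℂ) ^ 6 * hw
    rintro W (rfl | rfl)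
    · exact hkey _ (power_mul_line_sq ha hb hc hd hx hy (hinj hXY) (hinj hPP') (hinj hDP)
        (hinj hDP') h1 h2 h3 hxd hyd (hcircle hXγ') (hcircle hYγ'))
    · exact hkey _ (power_mul_line_sq ha hc hb hd hx hy (hinj hXY) (hinj hPP') (hinj hDP)
        (hinj hDP') (by linear_combination h1) (by linear_combination h2)
        (by linear_combination h3) hxd hyd (hcircle hXγ') (hcircle hYγ'))
  have hLP : signedArea P P' P = 0 := by simp [signedArea]
  have hLZ : signedArea P P' Z = 0 := by
    obtain ⟨t, rfl⟩ := hZline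
    simp [signedArea]
    ring
  obtain ⟨a', b', c', d', e', f', heval, hgrad⟩ := exists_conicEval_pencil
    (signedArea P P' A ^ 2) (Complex.normSq (A - O₁) - r₁ ^ 2) P P' O₁ r₁
  obtain ⟨a, b, c, d, e, f, hne, rfl⟩ := hE
  obtain ⟨k, ha, hb, hc, hd, he, -⟩ := conic_coeffs_proportional hne hAE hBE hCE hPE hZE
    (by rw [heval]; ring) (by rw [heval]; exact hpower B (by simp))
    (by rw [heval]; exact hpower C (by simp))
    (by rw [heval, hγ P hPγ, hLP]; ring) (by rw [heval, hγ Z hZγ, hLZ]; ring) h5Z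
  exact ⟨circleConicTangentAt_of_pencil hr₁ (pow_ne_zero 2 hLA) hne hPγ hPE (hgrad P hLP)
      ha hb hc hd he,
    circleConicTangentAt_of_pencil hr₁ (pow_ne_zero 2 hLA) hne hZγ hZE (hgrad Z hLZ)
      ha hb hc hd he⟩

end
end

section
/- Let Ω and ω be two circles meeting at a point X. Let A, B, C, D be points of ω distinct from X with A ≠ B, C ≠ D and line AB parallel to line CD. Let E, F, G, H be the second intersections with Ω of lines XA, XB, XC, XD respectively (each distinct from X), with E ≠ F and G ≠ H. Then line EF is parallel to line GH. -/
noncomputable section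

open ComplexConjugate in
/-- A point `z` on a circle through `X` with center `O` satisfies
`|z - X|² = 2 Re ((z - X) * conj (O - X))`. -/
theorem mul_conj_sub_of_mem_circleSet {O X z : ℂ} {r : ℝ}
    (hX : X ∈ circleSet O r) (hz : z ∈ circleSet O r) :
    (z - X) * conj (z - X) = (z - X) * conj (O - X) + conj (z - X) * (O - X) := by
  have hX' : (X - O) * conj (X - O) = (r : ℂ) ^ 2 := by
    rw [Complex.mul_conj', show ‖X - O‖ = r from hX]
  have hz' : (z - O) * conj (z - O) = (r : ℂ) ^ 2 := by
    rw [Complex.mul_conj', show ‖z - O‖ = r from hz]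
  simp only [map_sub] at *
  linear_combination hz' - hX'

open ComplexConjugate in
/-- If two circles meet at `X`, the map sending a point `A` of the second circle to the second
intersection `E` of the line `XA` with the first circle is the restriction of a similarity
taking center to center. -/
theorem sub_center_mul_conj_eq {O O' X A E : ℂ} {r r' : ℝ}
    (hX : X ∈ circleSet O r) (hX' : X ∈ circleSet O' r')
    (hA : A ∈ circleSet O' r') (hAX : A ≠ X)
    (hE : E ∈ circleSet O r) (hEl : E ∈ lineThrough X A) (hEX : E ≠ X) :
    (E - O) * conj (O' - X) = conj (O - X) * (A - O') := by
  obtain ⟨s, rfl⟩ := hEl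
  have hs : (s : ℂ) ≠ 0 := by
    intro h
    apply hEX
    simp [Complex.ofReal_eq_zero.mp h]
  have hconj : conj (A - X) ≠ 0 := (map_ne_zero _).mpr (sub_ne_zero.mpr hAX)
  have hAeq := mul_conj_sub_of_mem_circleSet hX' hA
  have hEeq := mul_conj_sub_of_mem_circleSet hX hE
  simp only [Complex.real_smul, add_sub_cancel_left, map_mul, Complex.conj_ofReal] at hEeq ⊢
  have hEeq' : s * ((A - X) * conj (A - X)) =
      (A - X) * conj (O - X) + conj (A - X) * (O - X) := by
    apply mul_left_cancel₀ hs
    linear_combination hEeq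
  apply mul_right_cancel₀ hconj
  linear_combination conj (O' - X) * hEeq' - conj (O - X) * hAeq

theorem statement8 (O O' : ℂ) (r r' : ℝ) (hr : 0 < r) (hr' : 0 < r')
    (Ω ω : Set ℂ) (hΩ : Ω = circleSet O r) (hω : ω = circleSet O' r')
    (X : ℂ) (hXΩ : X ∈ Ω) (hXω : X ∈ ω)
    (A B C D : ℂ) (hAω : A ∈ ω) (hBω : B ∈ ω) (hCω : C ∈ ω) (hDω : D ∈ ω)
    (hAX : A ≠ X) (hBX : B ≠ X) (hCX : C ≠ X) (hDX : D ≠ X)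
    (hAB : A ≠ B) (hCD : C ≠ D)
    (hpar : ∃ t : ℝ, B - A = t • (D - C))
    (E F G W : ℂ)
    (hE : E ∈ Ω) (hEl : E ∈ lineThrough X A) (hEX : E ≠ X)
    (hF : F ∈ Ω) (hFl : F ∈ lineThrough X B) (hFX : F ≠ X)
    (hG : G ∈ Ω) (hGl : G ∈ lineThrough X C) (hGX : G ≠ X)
    (hW : W ∈ Ω) (hWl : W ∈ lineThrough X D) (hWX : W ≠ X)
    (hEF : E ≠ F) (hGW : G ≠ W) :
    ∃ t : ℝ, F - E = t • (W - G) := by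
  subst hΩ hω
  obtain ⟨t, ht⟩ := hpar
  have hO' : (starRingEnd ℂ) (O' - X) ≠ 0 := by
    intro h
    have hOX : O' = X := sub_eq_zero.mp ((map_eq_zero _).mp h)
    have hXr : ‖X - O'‖ = r' := hXω
    rw [hOX, sub_self, norm_zero] at hXr
    exact hr'.ne hXr
  have eE := sub_center_mul_conj_eq hXΩ hXω hAω hAX hE hEl hEX
  have eF := sub_center_mul_conj_eq hXΩ hXω hBω hBX hF hFl hFX
  have eG := sub_center_mul_conj_eq hXΩ hXω hCω hCX hG hGl hGX
  have eW := sub_center_mul_conj_eq hXΩ hXω hDω hDX hW hWl hWX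
  refine ⟨t, mul_right_cancel₀ hO' ?_⟩
  rw [Complex.real_smul] at ht ⊢
  linear_combination eF - eE - t * (eW - eG) + (starRingEnd ℂ) (O - X) * ht

end
end

section
/- Let A, B, C, D, E, F be six pairwise distinct points in ℂ such that A, B, C, D are concyclic, A, B, E, F are concyclic, and line CD is parallel to line EF. Then there is a single conic passing through all six points A, B, C, D, E, F. -/
noncomputable section

/-- Membership in a circle, expanded in real coordinates. -/
theorem sq_add_sq_of_mem_circleSet {O z : ℂ} {r : ℝ} (hz : z ∈ circleSet O r) :
    (z.re - O.re) ^ 2 + (z.im - O.im) ^ 2 = r ^ 2 := by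
  have hr : ‖z - O‖ = r := hz
  rw [← hr, Complex.sq_norm, Complex.normSq_apply, Complex.sub_re, Complex.sub_im]
  ring

theorem statement10 (A B C D E F : ℂ)
    (hdist : List.Pairwise (· ≠ ·) [A, B, C, D, E, F])
    (h1 : Concyclic4 A B C D) (h2 : Concyclic4 A B E F)
    (hpar : ∃ t : ℝ, D - C = t • (F - E)) :
    ∃ S : Set ℂ, IsConic S ∧ A ∈ S ∧ B ∈ S ∧ C ∈ S ∧ D ∈ S ∧ E ∈ S ∧ F ∈ S := by
  obtain ⟨O₁, r₁, -, hA₁, hB₁, hC, hD⟩ := h1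
  obtain ⟨O₂, r₂, -, hA₂, hB₂, hE, hF⟩ := h2
  obtain ⟨t, ht⟩ := hpar
  have hEF : E ≠ F := by simp at hdist; tauto
  apply sq_add_sq_of_mem_circleSet at hA₁
  apply sq_add_sq_of_mem_circleSet at hB₁
  apply sq_add_sq_of_mem_circleSet at hC
  apply sq_add_sq_of_mem_circleSet at hD
  apply sq_add_sq_of_mem_circleSet at hA₂
  apply sq_add_sq_of_mem_circleSet at hB₂
  apply sq_add_sq_of_mem_circleSet at hE
  apply sq_add_sq_of_mem_circleSet at hF
  by_cases hO : O₁ = O₂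
  · subst hO
    refine ⟨_, ⟨1, 0, 1, -2 * O₁.re, -2 * O₁.im, O₁.re ^ 2 + O₁.im ^ 2 - r₁ ^ 2,
      by simp, rfl⟩, ?_, ?_, ?_, ?_, ?_, ?_⟩ <;>
      simp only [Set.mem_ofPred_eq, conicEval] <;> linarith
  have htre : D.re - C.re = t * (F.re - E.re) := by simpa using congrArg Complex.re ht
  have htim : D.im - C.im = t * (F.im - E.im) := by simpa using congrArg Complex.im ht
  -- The radical axis of the two circles is `u * x + v * y + w = 0`, and `(p, q)` is normal
  -- to `CD` and `EF`. With `Γ₁` the equation of the first circle, the conic is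
  -- `(u * x + v * y + w) * (p * x + q * y - c) - m * Γ₁ = 0`.
  obtain ⟨u, hu⟩ : ∃ u, u = 2 * (O₂.re - O₁.re) := ⟨_, rfl⟩
  obtain ⟨v, hv⟩ : ∃ v, v = 2 * (O₂.im - O₁.im) := ⟨_, rfl⟩
  obtain ⟨w, hw⟩ : ∃ w, w = O₁.re ^ 2 + O₁.im ^ 2 - r₁ ^ 2 - (O₂.re ^ 2 + O₂.im ^ 2 - r₂ ^ 2) :=
    ⟨_, rfl⟩
  obtain ⟨p, hp⟩ : ∃ p, p = -(F.im - E.im) := ⟨_, rfl⟩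
  obtain ⟨q, hq⟩ : ∃ q, q = F.re - E.re := ⟨_, rfl⟩
  obtain ⟨c, hc⟩ : ∃ c, c = p * C.re + q * C.im := ⟨_, rfl⟩
  obtain ⟨m, hm⟩ : ∃ m, m = p * E.re + q * E.im - c := ⟨_, rfl⟩
  have hcD : p * D.re + q * D.im = c := by
    rw [hc, hp, hq]
    linear_combination -(F.im - E.im) * htre + (F.re - E.re) * htim
  have hmF : m = p * F.re + q * F.im - c := by
    rw [hm, hp, hq]
    ring
  refine ⟨_, ⟨u * p - m, u * q + v * p, v * q - m, w * p - u * c + 2 * m * O₁.re,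
    w * q - v * c + 2 * m * O₁.im, -(w * c) - m * (O₁.re ^ 2 + O₁.im ^ 2 - r₁ ^ 2),
    ?_, rfl⟩, ?_, ?_, ?_, ?_, ?_, ?_⟩
  · rintro ⟨ha, hb, hcc, -⟩
    have hprod : (⟨u, v⟩ : ℂ) * ⟨p, q⟩ = 0 := by
      apply Complex.ext <;> simp <;> linarith
    rcases mul_eq_zero.1 hprod with h | h
    · have hre : u = 0 := congrArg Complex.re h
      have him : v = 0 := congrArg Complex.im h
      exact hO (Complex.ext (by linarith) (by linarith))
    · have hre : p = 0 := congrArg Complex.re h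
      have him : q = 0 := congrArg Complex.im h
      exact hEF (Complex.ext (by linarith) (by linarith))
  all_goals simp only [Set.mem_ofPred_eq, conicEval]
  · have hL : u * A.re + v * A.im + w = 0 := by rw [hu, hv, hw]; linarith
    linear_combination (p * A.re + q * A.im - c) * hL - m * hA₁
  · have hL : u * B.re + v * B.im + w = 0 := by rw [hu, hv, hw]; linarith
    linear_combination (p * B.re + q * B.im - c) * hL - m * hB₁
  · linear_combination -(u * C.re + v * C.im + w) * hc - m * hC
  · linear_combination (u * D.re + v * D.im + w) * hcD - m * hD
  · have hL : u * E.re + v * E.im + w =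
        (E.re - O₁.re) ^ 2 + (E.im - O₁.im) ^ 2 - r₁ ^ 2 := by rw [hu, hv, hw]; linarith
    linear_combination m * hL - (u * E.re + v * E.im + w) * hm
  · have hL : u * F.re + v * F.im + w =
        (F.re - O₁.re) ^ 2 + (F.im - O₁.im) ^ 2 - r₁ ^ 2 := by rw [hu, hv, hw]; linarith
    linear_combination m * hL - (u * F.re + v * F.im + w) * hmF


end
end

section
/- Assume the main configuration, with Z ≠ P and no three of A, B, C, P, X collinear. Let X₁ ≠ X₂ be points of the conic (ABCPX) such that P, X, X₁, X₂ are four pairwise distinct concyclic points. Then line X₁X₂ is parallel to line PZ. -/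
noncomputable section

open scoped ComplexConjugate

/-- A cubic polynomial with four distinct roots is zero. -/
lemma cubic_coeffs_eq_zero {K : Type*} [Field K] {c₀ c₁ c₂ c₃ x y z w : K}
    (hxy : x ≠ y) (hxz : x ≠ z) (hxw : x ≠ w) (hyz : y ≠ z) (hyw : y ≠ w) (hzw : z ≠ w)
    (hx : c₃ * x ^ 3 + c₂ * x ^ 2 + c₁ * x + c₀ = 0)
    (hy : c₃ * y ^ 3 + c₂ * y ^ 2 + c₁ * y + c₀ = 0)
    (hz : c₃ * z ^ 3 + c₂ * z ^ 2 + c₁ * z + c₀ = 0)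
    (hw : c₃ * w ^ 3 + c₂ * w ^ 2 + c₁ * w + c₀ = 0) :
    c₃ = 0 ∧ c₂ = 0 ∧ c₁ = 0 ∧ c₀ = 0 := by
  have first : ∀ v, x ≠ v → c₃ * v ^ 3 + c₂ * v ^ 2 + c₁ * v + c₀ = 0 →
      c₃ * (x ^ 2 + x * v + v ^ 2) + c₂ * (x + v) + c₁ = 0 := fun v hv h =>
    mul_left_cancel₀ (sub_ne_zero.2 hv) (by linear_combination hx - h)
  have second : ∀ v, y ≠ v → x ≠ v → c₃ * v ^ 3 + c₂ * v ^ 2 + c₁ * v + c₀ = 0 →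
      c₃ * (x + y + v) + c₂ = 0 := fun v hyv hxv h =>
    mul_left_cancel₀ (sub_ne_zero.2 hyv) (by linear_combination first y hxy hy - first v hxv h)
  have h₃ : c₃ = 0 := mul_left_cancel₀ (sub_ne_zero.2 hzw)
    (by linear_combination second z hyz hxz hz - second w hyw hxw hw)
  subst h₃
  have h₂ : c₂ = 0 := by simpa using second z hyz hxz hz
  subst h₂
  have h₁ : c₁ = 0 := by simpa using first y hxy hy
  subst h₁
  exact ⟨rfl, rfl, rfl, by simpa using hx⟩

/-- Vieta's formulas for a polynomial of degree at most four with four distinct roots. -/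
lemma quartic_vieta {K : Type*} [Field K] {c₀ c₁ c₂ c₃ c₄ x y z w : K}
    (hxy : x ≠ y) (hxz : x ≠ z) (hxw : x ≠ w) (hyz : y ≠ z) (hyw : y ≠ w) (hzw : z ≠ w)
    (hx : c₄ * x ^ 4 + c₃ * x ^ 3 + c₂ * x ^ 2 + c₁ * x + c₀ = 0)
    (hy : c₄ * y ^ 4 + c₃ * y ^ 3 + c₂ * y ^ 2 + c₁ * y + c₀ = 0)
    (hz : c₄ * z ^ 4 + c₃ * z ^ 3 + c₂ * z ^ 2 + c₁ * z + c₀ = 0)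
    (hw : c₄ * w ^ 4 + c₃ * w ^ 3 + c₂ * w ^ 2 + c₁ * w + c₀ = 0) :
    c₃ = -c₄ * (x + y + z + w) ∧
    c₂ = c₄ * (x * y + x * z + x * w + y * z + y * w + z * w) ∧
    c₁ = -c₄ * (x * y * z + x * y * w + x * z * w + y * z * w) ∧
    c₀ = c₄ * (x * y * z * w) := by
  obtain ⟨h₃, h₂, h₁, h₀⟩ := cubic_coeffs_eq_zero
    (c₃ := c₃ + c₄ * (x + y + z + w))
    (c₂ := c₂ - c₄ * (x * y + x * z + x * w + y * z + y * w + z * w))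
    (c₁ := c₁ + c₄ * (x * y * z + x * y * w + x * z * w + y * z * w))
    (c₀ := c₀ - c₄ * (x * y * z * w)) hxy hxz hxw hyz hyw hzw
    (by linear_combination hx) (by linear_combination hy)
    (by linear_combination hz) (by linear_combination hw)
  exact ⟨by linear_combination h₃, by linear_combination h₂, by linear_combination h₁,
    by linear_combination h₀⟩

/-- A real quadratic polynomial written in the variables `z` and `conj z`. -/
def conjQuadratic (α γ : ℂ) (β κ : ℝ) (z : ℂ) : ℂ :=
  α * z ^ 2 + β * (z * conj z) + conj α * conj z ^ 2 + γ * z + conj γ * conj z + κ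

/-- An affine change of coordinate turns the equation of a conic into the vanishing of a nonzero
`conjQuadratic`. -/
lemma IsConic.exists_conjQuadratic {S : Set ℂ} (hS : IsConic S) (O : ℂ) {r : ℝ} (hr : 0 < r) :
    ∃ (α γ : ℂ) (β κ : ℝ), ¬(α = 0 ∧ γ = 0 ∧ β = 0 ∧ κ = 0) ∧
      ∀ w : ℂ, O + r * w ∈ S → conjQuadratic α γ β κ w = 0 := by
  obtain ⟨a, b, c, d, e, f, hne, rfl⟩ := hS
  have hr0 : (r : ℂ) ≠ 0 := by exact_mod_cast hr.ne'
  let α₀ : ℂ := ⟨(a - c) / 4, -b / 4⟩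
  let γ₀ : ℂ := ⟨d / 2, -e / 2⟩
  let β₀ : ℝ := (a + c) / 2
  refine ⟨r ^ 2 * α₀, r * (γ₀ + 2 * α₀ * O + β₀ * conj O), r ^ 2 * β₀,
    conicEval a b c d e f O, ?_, ?_⟩
  · rintro ⟨hα, hγ, hβ, hκ⟩
    have hα₀ : α₀ = 0 := by simpa [hr0] using hα
    have hβ₀ : β₀ = 0 := by simpa [hr.ne'] using hβ
    have hγ₀ : γ₀ = 0 := by simpa [hr0, hα₀, hβ₀] using hγ
    have h1 : (a - c) / 4 = 0 := congrArg Complex.re hα₀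
    have h2 : -b / 4 = 0 := congrArg Complex.im hα₀
    have h3 : d / 2 = 0 := congrArg Complex.re hγ₀
    have h4 : -e / 2 = 0 := congrArg Complex.im hγ₀
    have h5 : (a + c) / 2 = 0 := hβ₀
    obtain rfl : a = 0 := by linarith
    obtain rfl : b = 0 := by linarith
    obtain rfl : c = 0 := by linarith
    obtain rfl : d = 0 := by linarith
    obtain rfl : e = 0 := by linarith
    exact hne ⟨rfl, rfl, rfl, rfl, rfl, by simpa [conicEval] using hκ⟩
  · intro w hw
    have hw' : conicEval a b c d e f (O + r * w) = 0 := hw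
    have key : conjQuadratic (r ^ 2 * α₀) (r * (γ₀ + 2 * α₀ * O + β₀ * conj O)) (r ^ 2 * β₀)
        (conicEval a b c d e f O) w = (conicEval a b c d e f (O + r * w) : ℝ) := by
      apply Complex.ext <;>
        simp [conjQuadratic, conicEval, α₀, γ₀, pow_two] <;> simp only [β₀] <;> ring
    rw [key, hw', Complex.ofReal_zero]

/-- On the unit circle, a `conjQuadratic` becomes a quartic polynomial in `z`. -/
lemma quartic_eq_zero_of_conjQuadratic {α γ : ℂ} {β κ : ℝ} {z : ℂ} (hz : z * conj z = 1)
    (h : conjQuadratic α γ β κ z = 0) :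
    α * z ^ 4 + γ * z ^ 3 + (β + κ) * z ^ 2 + conj γ * z + conj α = 0 := by
  unfold conjQuadratic at h
  linear_combination z ^ 2 * h -
    (β * z ^ 2 + conj α * (z * conj z + 1) + conj γ * z) * hz

/-- The quadratic part of a conic meeting a circle in four distinct points is determined, up to
real factors, by the directions of two opposite chords. -/
lemma conj_mul_chords {α γ : ℂ} {β κ : ℝ} {o x y z w : ℂ} {ρ : ℝ} (hρ : 0 < ρ)
    (hxy : x ≠ y) (hxz : x ≠ z) (hxw : x ≠ w) (hyz : y ≠ z) (hyw : y ≠ w) (hzw : z ≠ w)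
    (cx : ‖x - o‖ = ρ) (cy : ‖y - o‖ = ρ) (cz : ‖z - o‖ = ρ) (cw : ‖w - o‖ = ρ)
    (hx : conjQuadratic α γ β κ x = 0) (hy : conjQuadratic α γ β κ y = 0)
    (hz : conjQuadratic α γ β κ z = 0) (hw : conjQuadratic α γ β κ w = 0) :
    α * ((x - y) * (z - w)) = conj α * (conj (x - y) * conj (z - w)) := by
  have hρ0 : (ρ : ℂ) ≠ 0 := by exact_mod_cast hρ.ne'
  have unit : ∀ v : ℂ, ‖v - o‖ = ρ → (v - o) * (conj v - conj o) = ρ ^ 2 := fun v hv => by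
    rw [← map_sub, Complex.mul_conj, Complex.normSq_eq_norm_sq, hv]; norm_cast
  have quartic : ∀ v : ℂ, ‖v - o‖ = ρ → conjQuadratic α γ β κ v = 0 →
      α * (v - o) ^ 4 + (γ + 2 * α * o + β * conj o) * (v - o) ^ 3 +
      (β * ρ ^ 2 + conjQuadratic α γ β κ o) * (v - o) ^ 2 +
      ρ ^ 2 * (conj γ + 2 * conj α * conj o + β * o) * (v - o) + ρ ^ 4 * conj α = 0 := by
    intro v hv h
    have hu := unit v hv
    unfold conjQuadratic at h ⊢
    linear_combination (v - o) ^ 2 * h - (β * (v - o) ^ 2 +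
      conj α * ((v - o) * (conj v - conj o) + ρ ^ 2) +
      (conj γ + 2 * conj α * conj o + β * o) * (v - o)) * hu
  obtain ⟨-, -, -, h₀⟩ := quartic_vieta (fun h => hxy (sub_left_injective h))
    (fun h => hxz (sub_left_injective h)) (fun h => hxw (sub_left_injective h))
    (fun h => hyz (sub_left_injective h)) (fun h => hyw (sub_left_injective h))
    (fun h => hzw (sub_left_injective h))
    (quartic x cx hx) (quartic y cy hy) (quartic z cz hz) (quartic w cw hw)
  have chord : ∀ u v : ℂ, ‖u - o‖ = ρ → ‖v - o‖ = ρ →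
      (u - o) * (v - o) * conj (u - v) = -(ρ ^ 2 * (u - v)) := fun u v hu hv => by
    rw [map_sub]
    linear_combination (v - o) * unit u hu - (u - o) * unit v hv
  have hxyc := chord x y cx cy
  have hzwc := chord z w cz cw
  apply mul_left_cancel₀ (pow_ne_zero 4 hρ0)
  linear_combination -(conj (x - y) * conj (z - w)) * h₀ +
    α * (ρ ^ 2 * (z - w)) * hxyc - α * ((x - o) * (y - o) * conj (x - y)) * hzwc

/-- A conic meeting the unit circle in four distinct points and containing a point off the unit
circle has nonvanishing `z ^ 2` coefficient, and Vieta's formulas hold. -/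
lemma conjQuadratic_vieta {α γ : ℂ} {β κ : ℝ} {x y z w p : ℂ}
    (hne : ¬(α = 0 ∧ γ = 0 ∧ β = 0 ∧ κ = 0))
    (hxy : x ≠ y) (hxz : x ≠ z) (hxw : x ≠ w) (hyz : y ≠ z) (hyw : y ≠ w) (hzw : z ≠ w)
    (cx : x * conj x = 1) (cy : y * conj y = 1) (cz : z * conj z = 1) (cw : w * conj w = 1)
    (hx : conjQuadratic α γ β κ x = 0) (hy : conjQuadratic α γ β κ y = 0)
    (hz : conjQuadratic α γ β κ z = 0) (hw : conjQuadratic α γ β κ w = 0)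
    (hp : conjQuadratic α γ β κ p = 0) (hpc : p * conj p ≠ 1) :
    α ≠ 0 ∧ γ = -α * (x + y + z + w) ∧
    (β + κ : ℂ) = α * (x * y + x * z + x * w + y * z + y * w + z * w) ∧
    conj γ = -α * (x * y * z + x * y * w + x * z * w + y * z * w) ∧
    conj α = α * (x * y * z * w) := by
  obtain ⟨h₃, h₂, h₁, h₀⟩ := quartic_vieta hxy hxz hxw hyz hyw hzw
    (quartic_eq_zero_of_conjQuadratic cx hx) (quartic_eq_zero_of_conjQuadratic cy hy)
    (quartic_eq_zero_of_conjQuadratic cz hz) (quartic_eq_zero_of_conjQuadratic cw hw)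
  refine ⟨?_, h₃, h₂, h₁, h₀⟩
  rintro rfl
  have hγ : γ = 0 := by simpa using h₃
  subst hγ
  have hβκ : (κ : ℂ) = -β := by linear_combination h₂
  have hβ : (β : ℂ) * (p * conj p - 1) = 0 := by
    unfold conjQuadratic at hp
    simp only [map_zero, zero_mul, hβκ] at hp
    linear_combination hp
  have hβ0 : (β : ℂ) = 0 := (mul_eq_zero.1 hβ).resolve_right (sub_ne_zero.2 hpc)
  rw [hβ0, neg_zero] at hβκ
  exact hne ⟨rfl, rfl, by exact_mod_cast hβ0, by exact_mod_cast hβκ⟩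

/-- The isogonality condition at a vertex of a triangle inscribed in the unit circle. -/
lemma isogonal_vertex_equation {a b c p q : ℂ} (hab : a ≠ b) (hac : a ≠ c)
    (ca : a * conj a = 1) (cb : b * conj b = 1) (cc : c * conj c = 1)
    (h : ((p - a) * (q - a) / ((b - a) * (c - a))).im = 0) :
    p * q + a * b * c * (conj p + conj q) - (a * b + a * c + b * c) =
      a * (p + q + a * b * c * (conj p * conj q) - (a + b + c)) := by
  have hb : b - a ≠ 0 := sub_ne_zero.2 hab.symm
  have hc : c - a ≠ 0 := sub_ne_zero.2 hac.symm
  have h' := Complex.conj_eq_iff_im.2 h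
  have hb' : conj b - conj a ≠ 0 := by rwa [← map_sub, ne_eq, map_eq_zero]
  have hc' : conj c - conj a ≠ 0 := by rwa [← map_sub, ne_eq, map_eq_zero]
  simp only [map_div₀, map_mul, map_sub] at h'
  rw [div_eq_div_iff (mul_ne_zero hb' hc') (mul_ne_zero hb hc)] at h'
  have eb : b - a = -(a * b * (conj b - conj a)) := by linear_combination a * cb - b * ca
  have ec : c - a = -(a * c * (conj c - conj a)) := by linear_combination a * cc - c * ca
  have h'' : (p - a) * (q - a) = (conj p - conj a) * (conj q - conj a) * (a * b * (a * c)) := by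
    apply mul_right_cancel₀ (mul_ne_zero hb' hc')
    rw [← h', eb, ec]; ring
  linear_combination h'' + a * b * c * (conj a - conj p - conj q) * ca + b * c * ca

/-- If `p` and `q` are isogonal conjugates in a triangle inscribed in the unit circle, then
`p + q + abc * conj (p * q) = a + b + c`, together with the conjugate relation. -/
lemma IsogConj.unit_circle {a b c p q : ℂ} (hab : a ≠ b) (hac : a ≠ c) (hbc : b ≠ c)
    (ca : a * conj a = 1) (cb : b * conj b = 1) (cc : c * conj c = 1)
    (h : IsogConj a b c p q) :
    p + q + a * b * c * (conj p * conj q) = a + b + c ∧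
    p * q + a * b * c * (conj p + conj q) = a * b + a * c + b * c := by
  have ha := isogonal_vertex_equation hab hac ca cb cc h.1
  have hb := isogonal_vertex_equation hbc hab.symm cb cc ca h.2.1
  have hV : p + q + a * b * c * (conj p * conj q) - (a + b + c) = 0 :=
    mul_left_cancel₀ (sub_ne_zero.2 hab) (by linear_combination hb - ha)
  exact ⟨by linear_combination hV, by linear_combination ha + a * hV⟩

/-- A point of the circumcircle with a finite isogonal conjugate is a vertex. -/
lemma mul_conj_ne_one_of_isogonal {a b c p q : ℂ} (hpa : p ≠ a) (hpb : p ≠ b) (hpc : p ≠ c)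
    (h₁ : p + q + a * b * c * (conj p * conj q) = a + b + c)
    (h₂ : p * q + a * b * c * (conj p + conj q) = a * b + a * c + b * c) :
    p * conj p ≠ 1 := by
  intro h
  have key : (p - a) * ((p - b) * (p - c)) = 0 := by
    linear_combination p ^ 2 * h₁ - p * h₂ + a * b * c * (1 - p * conj q) * h
  exact mul_ne_zero (sub_ne_zero.2 hpa)
    (mul_ne_zero (sub_ne_zero.2 hpb) (sub_ne_zero.2 hpc)) key

/-- Let `p`, `q` be isogonal conjugates in a triangle `abc` inscribed in the unit circle. The
fourth intersection `d` of the unit circle with the conic `abcpq` is the isogonal conjugate of the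
point at infinity of the line `pq`. -/
lemma direction_of_isogonal_conic {α γ : ℂ} {β κ : ℝ} {a b c d p q : ℂ}
    (hne : ¬(α = 0 ∧ γ = 0 ∧ β = 0 ∧ κ = 0))
    (hab : a ≠ b) (hac : a ≠ c) (had : a ≠ d) (hbc : b ≠ c) (hbd : b ≠ d) (hcd : c ≠ d)
    (ca : a * conj a = 1) (cb : b * conj b = 1) (cc : c * conj c = 1) (cd : d * conj d = 1)
    (ha : conjQuadratic α γ β κ a = 0) (hb : conjQuadratic α γ β κ b = 0)
    (hc : conjQuadratic α γ β κ c = 0) (hd : conjQuadratic α γ β κ d = 0)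
    (hp : conjQuadratic α γ β κ p = 0) (hq : conjQuadratic α γ β κ q = 0)
    (hpc : p * conj p ≠ 1) (hqc : q * conj q ≠ 1)
    (h₁ : p + q + a * b * c * (conj p * conj q) = a + b + c)
    (h₂ : p * q + a * b * c * (conj p + conj q) = a * b + a * c + b * c) :
    d * (q - p) = -(a * b * c) * conj (q - p) := by
  obtain ⟨hα, h₃, hβκ, h₁', h₀⟩ := conjQuadratic_vieta hne hab hac had hbc hbd hcd
    ca cb cc cd ha hb hc hd hp hpc
  have hκ : (κ : ℂ) = α * (a * b + a * c + a * d + b * c + b * d + c * d) - β := by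
    linear_combination hβκ
  have coeff : ∀ u v : ℂ, u * conj u ≠ 1 → conjQuadratic α γ β κ u = 0 →
      u + v + a * b * c * (conj u * conj v) = a + b + c →
      u * v + a * b * c * (conj u + conj v) = a * b + a * c + b * c →
      (β : ℂ) = α * (d * v + a * b * c * conj v) := by
    intro u v huc hu e₁ e₂
    apply mul_right_cancel₀ (sub_ne_zero.2 huc)
    unfold conjQuadratic at hu
    rw [h₁', h₀, hκ, h₃] at hu
    linear_combination hu - α * (u - d) * e₁ - α * (d * conj u - 1) * e₂
  have hβp := coeff p q hpc hp h₁ h₂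
  have hβq := coeff q p hqc hq (by linear_combination h₁) (by linear_combination h₂)
  rw [map_sub]
  exact mul_left_cancel₀ hα (by linear_combination hβq - hβp)

lemma NoThreeCollinear.ne {l : List ℂ} (h : NoThreeCollinear l) {i j k : Fin l.length}
    (hij : i ≠ j) (hik : i ≠ k) (hjk : j ≠ k) : l.get i ≠ l.get j := by
  intro e
  apply h i j k hij hik hjk
  rw [e, Set.insert_eq_of_mem (Set.mem_insert _ _)]
  exact collinear_pair ℝ _ _

/-- The isogonal conjugacy relation is invariant under similarities. -/
lemma IsogConj.normalize {A B C P P' : ℂ} (h : IsogConj A B C P P') (O : ℂ) {r : ℝ}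
    (hr : 0 < r) :
    IsogConj ((A - O) / r) ((B - O) / r) ((C - O) / r) ((P - O) / r) ((P' - O) / r) := by
  have hr0 : (r : ℂ) ≠ 0 := by exact_mod_cast hr.ne'
  have key : ∀ u v w x y : ℂ, ((x - O) / r - (u - O) / r) * ((y - O) / r - (u - O) / r) /
      (((v - O) / r - (u - O) / r) * ((w - O) / r - (u - O) / r)) =
      (x - u) * (y - u) / ((v - u) * (w - u)) := by
    intro u v w x y
    have e : ∀ s t : ℂ, (s - O) / r - (t - O) / r = (s - t) / r := fun s t => by ring
    rw [e, e, e, e, div_mul_div_comm, div_mul_div_comm,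
      div_div_div_cancel_right₀ (mul_ne_zero hr0 hr0)]
  unfold IsogConj
  rw [key, key, key]
  exact h

/-- In the normalized configuration, any chord cut from the conic `abcpx` by a circle through `p`
and `x` is parallel to the line `pq`. -/
lemma chord_direction {α γ : ℂ} {β κ : ℝ} {a b c d p q x x₁ x₂ o : ℂ} {ρ s : ℝ}
    (hne : ¬(α = 0 ∧ γ = 0 ∧ β = 0 ∧ κ = 0)) (hρ : 0 < ρ)
    (hab : a ≠ b) (hac : a ≠ c) (hax : a ≠ x) (hbc : b ≠ c) (hbx : b ≠ x) (hcx : c ≠ x)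
    (hpx : p ≠ x) (hpx₁ : p ≠ x₁) (hpx₂ : p ≠ x₂) (hxx₁ : x ≠ x₁) (hxx₂ : x ≠ x₂)
    (hx₁₂ : x₁ ≠ x₂)
    (ca : a * conj a = 1) (cb : b * conj b = 1) (cc : c * conj c = 1) (cd : d * conj d = 1)
    (cx : x * conj x = 1) (hpc : p * conj p ≠ 1)
    (ha : conjQuadratic α γ β κ a = 0) (hb : conjQuadratic α γ β κ b = 0)
    (hc : conjQuadratic α γ β κ c = 0) (hp : conjQuadratic α γ β κ p = 0)
    (hx : conjQuadratic α γ β κ x = 0) (hx₁ : conjQuadratic α γ β κ x₁ = 0)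
    (hx₂ : conjQuadratic α γ β κ x₂ = 0)
    (op : ‖p - o‖ = ρ) (ox : ‖x - o‖ = ρ) (ox₁ : ‖x₁ - o‖ = ρ) (ox₂ : ‖x₂ - o‖ = ρ)
    (hline : x - d = s * (p - d)) (hxd : x ≠ d)
    (hdir : d * (q - p) = -(a * b * c) * conj (q - p)) :
    (x₂ - x₁) * conj (q - p) = conj (x₂ - x₁) * (q - p) := by
  obtain ⟨hα, -, -, -, h₀⟩ := conjQuadratic_vieta hne hab hac hax hbc hbx hcx
    ca cb cc cx ha hb hc hx hp hpc
  have hchord := conj_mul_chords hρ hpx hpx₂ hpx₁ hxx₂ hxx₁ hx₁₂.symm op ox ox₂ ox₁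
    hp hx hx₂ hx₁
  have hd0 : d ≠ 0 := left_ne_zero_of_mul_eq_one cd
  have habc : a * b * c ≠ 0 := mul_ne_zero (mul_ne_zero (left_ne_zero_of_mul_eq_one ca)
    (left_ne_zero_of_mul_eq_one cb)) (left_ne_zero_of_mul_eq_one cc)
  have hline' : conj x - conj d = s * (conj p - conj d) := by
    simpa using congrArg conj hline
  have hpx_line : s * (p - x) = (1 - s) * (x - d) := by linear_combination -hline
  have hpx_line' : s * (conj p - conj x) = (1 - s) * (conj x - conj d) := by
    linear_combination -hline'
  have hs : (1 - s : ℂ) ≠ 0 := by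
    intro hs
    exact hpx (by linear_combination -hline + (p - d) * hs)
  have hdx : d * x * (conj x - conj d) = -(x - d) := by
    linear_combination d * cx - x * cd
  have hu : d * (x₂ - x₁) = -(a * b * c) * conj (x₂ - x₁) := by
    apply mul_left_cancel₀ (mul_ne_zero hα (mul_ne_zero hs (sub_ne_zero.2 hxd)))
    rw [h₀, map_sub] at hchord
    linear_combination d * s * hchord - α * d * (x₂ - x₁) * hpx_line +
      α * (a * b * c) * x * d * conj (x₂ - x₁) * hpx_line' +
      α * (a * b * c) * (1 - s) * conj (x₂ - x₁) * hdx
  apply mul_left_cancel₀ (mul_ne_zero hd0 habc)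
  linear_combination (a * b * c) * conj (q - p) * hu - (a * b * c) * conj (x₂ - x₁) * hdir

theorem statement11
    (A B C O : ℂ) (r : ℝ) (Ω : Set ℂ)
    (hr : 0 < r) (hΩ : Ω = circleSet O r)
    (hAΩ : A ∈ Ω) (hBΩ : B ∈ Ω) (hCΩ : C ∈ Ω)
    (hABC : ¬ Collinear ℝ ({A, B, C} : Set ℂ))
    (P P' : ℂ) (hPP' : P ≠ P') (hconj : IsogConj A B C P P')
    (h5 : NoThreeCollinear [A, B, C, P, P'])
    (H : Set ℂ) (hH : IsConic H)
    (hAH : A ∈ H) (hBH : B ∈ H) (hCH : C ∈ H) (hPH : P ∈ H) (hP'H : P' ∈ H)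
    (D : ℂ) (hDΩ : D ∈ Ω) (hDH : D ∈ H) (hDA : D ≠ A) (hDB : D ≠ B) (hDC : D ≠ C)
    (hDP : D ≠ P) (hDP' : D ≠ P')
    (X : ℂ) (hXD : X ≠ D) (hXΩ : X ∈ Ω) (hXline : X ∈ lineThrough D P)
    (Y : ℂ) (hYD : Y ≠ D) (hYΩ : Y ∈ Ω) (hYline : Y ∈ lineThrough D P')
    (hPXY : ¬ Collinear ℝ ({P, X, Y} : Set ℂ))
    (O₁ : ℂ) (r₁ : ℝ) (hr₁ : 0 < r₁)
    (hPγ : P ∈ circleSet O₁ r₁) (hXγ : X ∈ circleSet O₁ r₁) (hYγ : Y ∈ circleSet O₁ r₁)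
    (Z : ℂ) (hZP : Z ≠ P) (hZγ : Z ∈ circleSet O₁ r₁) (hZline : Z ∈ lineThrough P P')
    (h5X : NoThreeCollinear [A, B, C, P, X])
    (C₁ : Set ℂ) (hC₁ : IsConic C₁)
    (hAC₁ : A ∈ C₁) (hBC₁ : B ∈ C₁) (hCC₁ : C ∈ C₁) (hPC₁ : P ∈ C₁) (hXC₁ : X ∈ C₁)
    (X₁ X₂ : ℂ) (hX₁₂ : X₁ ≠ X₂) (hX₁C : X₁ ∈ C₁) (hX₂C : X₂ ∈ C₁)
    (hdist : List.Pairwise (· ≠ ·) [P, X, X₁, X₂])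
    (hcyc : Concyclic4 P X X₁ X₂) :
    ∃ t : ℝ, X₂ - X₁ = t • (Z - P) := by
  subst hΩ
  have hr0 : (r : ℂ) ≠ 0 := by exact_mod_cast hr.ne'
  let n : ℂ → ℂ := fun z => (z - O) / r
  have n_inv : ∀ z, O + r * n z = z := fun z => by simp only [n]; field_simp; ring
  have n_sub : ∀ z w, n z - n w = (z - w) / r := fun z w => by simp only [n]; ring
  have n_ne : ∀ {z w}, z ≠ w → n z ≠ n w := fun {z w} h e => h (by
    rw [← n_inv z, e, n_inv])
  have n_unit : ∀ {z}, z ∈ circleSet O r → n z * conj (n z) = 1 := fun {z} hz => by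
    have hz' : ‖z - O‖ = r := hz
    rw [Complex.mul_conj, Complex.normSq_eq_norm_sq, norm_div, hz', Complex.norm_real,
      Real.norm_of_nonneg hr.le, div_self hr.ne']
    norm_num
  have ne₅ : ∀ i j k : Fin 5, i ≠ j → i ≠ k → j ≠ k →
      [A, B, C, P, P'].get i ≠ [A, B, C, P, P'].get j := fun i j k => h5.ne
  have neX : ∀ i j k : Fin 5, i ≠ j → i ≠ k → j ≠ k →
      [A, B, C, P, X].get i ≠ [A, B, C, P, X].get j := fun i j k => h5X.ne
  have hAB : A ≠ B := ne₅ 0 1 2 (by decide) (by decide) (by decide)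
  have hAC : A ≠ C := ne₅ 0 2 1 (by decide) (by decide) (by decide)
  have hBC : B ≠ C := ne₅ 1 2 0 (by decide) (by decide) (by decide)
  have hPA : P ≠ A := ne₅ 3 0 1 (by decide) (by decide) (by decide)
  have hPB : P ≠ B := ne₅ 3 1 0 (by decide) (by decide) (by decide)
  have hPC : P ≠ C := ne₅ 3 2 0 (by decide) (by decide) (by decide)
  have hP'A : P' ≠ A := ne₅ 4 0 1 (by decide) (by decide) (by decide)
  have hP'B : P' ≠ B := ne₅ 4 1 0 (by decide) (by decide) (by decide)
  have hP'C : P' ≠ C := ne₅ 4 2 0 (by decide) (by decide) (by decide)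
  have hAX : A ≠ X := neX 0 4 1 (by decide) (by decide) (by decide)
  have hBX : B ≠ X := neX 1 4 0 (by decide) (by decide) (by decide)
  have hCX : C ≠ X := neX 2 4 0 (by decide) (by decide) (by decide)
  have hPX : P ≠ X := neX 3 4 0 (by decide) (by decide) (by decide)
  obtain ⟨h₁, h₂⟩ := (hconj.normalize O hr).unit_circle (n_ne hAB) (n_ne hAC) (n_ne hBC)
    (n_unit hAΩ) (n_unit hBΩ) (n_unit hCΩ)
  have hPc : n P * conj (n P) ≠ 1 :=
    mul_conj_ne_one_of_isogonal (n_ne hPA) (n_ne hPB) (n_ne hPC) h₁ h₂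
  have hP'c : n P' * conj (n P') ≠ 1 :=
    mul_conj_ne_one_of_isogonal (q := n P) (n_ne hP'A) (n_ne hP'B) (n_ne hP'C)
      (by linear_combination h₁) (by linear_combination h₂)
  obtain ⟨α, γ, β, κ, hne, hHn⟩ := hH.exists_conjQuadratic O hr
  have on_H : ∀ {z}, z ∈ H → conjQuadratic α γ β κ (n z) = 0 := fun {z} hz =>
    hHn _ (by rwa [n_inv])
  have hdir := direction_of_isogonal_conic hne (n_ne hAB) (n_ne hAC) (n_ne hDA.symm) (n_ne hBC)
    (n_ne hDB.symm) (n_ne hDC.symm) (n_unit hAΩ) (n_unit hBΩ) (n_unit hCΩ) (n_unit hDΩ)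
    (on_H hAH) (on_H hBH) (on_H hCH) (on_H hDH) (on_H hPH) (on_H hP'H) hPc hP'c h₁ h₂
  obtain ⟨α₁, γ₁, β₁, κ₁, hne₁, hC₁n⟩ := hC₁.exists_conjQuadratic O hr
  have on_C₁ : ∀ {z}, z ∈ C₁ → conjQuadratic α₁ γ₁ β₁ κ₁ (n z) = 0 := fun {z} hz =>
    hC₁n _ (by rwa [n_inv])
  obtain ⟨o, ρ, hρ, oP, oX, oX₁, oX₂⟩ := hcyc
  have n_circle : ∀ {z}, z ∈ circleSet o ρ → ‖n z - n o‖ = ρ / r := fun {z} hz => by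
    have hz' : ‖z - o‖ = ρ := hz
    rw [n_sub, norm_div, hz', Complex.norm_real, Real.norm_of_nonneg hr.le]
  obtain ⟨s, hs⟩ := hXline
  have hline : n X - n D = s * (n P - n D) := by
    rw [n_sub, n_sub, hs, Complex.real_smul]; ring
  simp only [List.pairwise_cons, List.mem_cons, List.not_mem_nil, or_false, forall_eq_or_imp,
    forall_eq] at hdist
  obtain ⟨⟨-, hPX₁, hPX₂⟩, ⟨hXX₁, hXX₂⟩, -⟩ := hdist
  have hpar := chord_direction hne₁ (div_pos hρ hr) (n_ne hAB) (n_ne hAC) (n_ne hAX) (n_ne hBC)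
    (n_ne hBX) (n_ne hCX) (n_ne hPX) (n_ne hPX₁) (n_ne hPX₂) (n_ne hXX₁) (n_ne hXX₂)
    (n_ne hX₁₂) (n_unit hAΩ) (n_unit hBΩ) (n_unit hCΩ) (n_unit hDΩ) (n_unit hXΩ) hPc
    (on_C₁ hAC₁) (on_C₁ hBC₁) (on_C₁ hCC₁) (on_C₁ hPC₁) (on_C₁ hXC₁) (on_C₁ hX₁C) (on_C₁ hX₂C)
    (n_circle oP) (n_circle oX) (n_circle oX₁) (n_circle oX₂) hline (n_ne hXD) hdir
  have hP'P : P' - P ≠ 0 := sub_ne_zero.2 hPP'.symm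
  have hP'Pc : conj (P' - P) ≠ 0 := (map_ne_zero _).2 hP'P
  have hreal : conj ((X₂ - X₁) / (P' - P)) = (X₂ - X₁) / (P' - P) := by
    rw [n_sub, n_sub, map_div₀, map_div₀, Complex.conj_ofReal] at hpar
    field_simp at hpar
    rw [map_div₀, div_eq_div_iff hP'Pc hP'P]
    linear_combination -hpar
  obtain ⟨u, hu⟩ := Complex.conj_eq_iff_real.1 hreal
  obtain ⟨t, ht⟩ := hZline
  rw [Complex.real_smul] at ht
  have ht0 : (t : ℂ) ≠ 0 := by
    intro h
    exact hZP (by rw [ht, h]; ring)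
  refine ⟨u / t, ?_⟩
  rw [div_eq_iff hP'P] at hu
  rw [Complex.real_smul, ht, hu]
  push_cast
  field_simp
  ring

end
end

section
/- Let ABC be a nondegenerate triangle in ℂ with circumcircle Ω. Let P and P′ be distinct isogonal conjugates with respect to ABC with no three of A, B, C, P, P′ collinear. Let D lie on both Ω and the conic (ABCPP′) with D ∉ {A, B, C}, and let D′ ≠ D be the point of Ω with line DD′ parallel to line PP′. Assume no three of A, B, C, D′, P are collinear. Then line PP′ is tangent to the conic (ABCD′P) at P if and only if there exists a point T of Ω lying on both line D′P and line DP′. -/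
noncomputable section

open ComplexConjugate

/-- A cubic polynomial with four distinct roots is zero. -/
lemma cubic_coeffs_eq_zero_s13 {k l m n a b c d : ℂ} (hab : a ≠ b) (hac : a ≠ c) (had : a ≠ d)
    (hbc : b ≠ c) (hbd : b ≠ d) (hcd : c ≠ d)
    (ha : k * a ^ 3 + l * a ^ 2 + m * a + n = 0) (hb : k * b ^ 3 + l * b ^ 2 + m * b + n = 0)
    (hc : k * c ^ 3 + l * c ^ 2 + m * c + n = 0) (hd : k * d ^ 3 + l * d ^ 2 + m * d + n = 0) :
    k = 0 ∧ l = 0 ∧ m = 0 ∧ n = 0 := by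
  have eb : k * (a ^ 2 + a * b + b ^ 2) + l * (a + b) + m = 0 :=
    mul_left_cancel₀ (sub_ne_zero.2 hab) (by linear_combination ha - hb)
  have ec : k * (a ^ 2 + a * c + c ^ 2) + l * (a + c) + m = 0 :=
    mul_left_cancel₀ (sub_ne_zero.2 hac) (by linear_combination ha - hc)
  have ed : k * (a ^ 2 + a * d + d ^ 2) + l * (a + d) + m = 0 :=
    mul_left_cancel₀ (sub_ne_zero.2 had) (by linear_combination ha - hd)
  have fc : k * (a + b + c) + l = 0 :=
    mul_left_cancel₀ (sub_ne_zero.2 hbc) (by linear_combination eb - ec)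
  have fd : k * (a + b + d) + l = 0 :=
    mul_left_cancel₀ (sub_ne_zero.2 hbd) (by linear_combination eb - ed)
  have hk : k = 0 := mul_left_cancel₀ (sub_ne_zero.2 hcd) (by linear_combination fc - fd)
  subst hk
  have hl : l = 0 := by linear_combination fc
  subst hl
  have hm : m = 0 := by linear_combination eb
  subst hm
  exact ⟨rfl, rfl, rfl, by linear_combination ha⟩

/-- Vieta's formulas for a monic cubic with three distinct roots. -/
lemma vieta_cubic {l m n a b c : ℂ} (hab : a ≠ b) (hac : a ≠ c) (hbc : b ≠ c)
    (ha : a ^ 3 - l * a ^ 2 + m * a - n = 0) (hb : b ^ 3 - l * b ^ 2 + m * b - n = 0)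
    (hc : c ^ 3 - l * c ^ 2 + m * c - n = 0) :
    l = a + b + c ∧ m = a * b + b * c + c * a := by
  have eb : a ^ 2 + a * b + b ^ 2 - l * (a + b) + m = 0 :=
    mul_left_cancel₀ (sub_ne_zero.2 hab) (by linear_combination ha - hb)
  have ec : a ^ 2 + a * c + c ^ 2 - l * (a + c) + m = 0 :=
    mul_left_cancel₀ (sub_ne_zero.2 hac) (by linear_combination ha - hc)
  have hl : l = a + b + c := by
    have : a + b + c - l = 0 :=
      mul_left_cancel₀ (sub_ne_zero.2 hbc) (by linear_combination eb - ec)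
    linear_combination -this
  exact ⟨hl, by linear_combination eb + (a + b) * hl⟩

/-- Vieta's formulas for a quartic with four distinct roots. -/
lemma vieta_quartic {k l m n o a b c d : ℂ} (hab : a ≠ b) (hac : a ≠ c) (had : a ≠ d)
    (hbc : b ≠ c) (hbd : b ≠ d) (hcd : c ≠ d)
    (ha : k * a ^ 4 + l * a ^ 3 + m * a ^ 2 + n * a + o = 0)
    (hb : k * b ^ 4 + l * b ^ 3 + m * b ^ 2 + n * b + o = 0)
    (hc : k * c ^ 4 + l * c ^ 3 + m * c ^ 2 + n * c + o = 0)
    (hd : k * d ^ 4 + l * d ^ 3 + m * d ^ 2 + n * d + o = 0) :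
    l = -k * (a + b + c + d) ∧
    m = k * (a * b + b * c + c * a + (a + b + c) * d) ∧
    n = -k * (a * b * c + (a * b + b * c + c * a) * d) ∧ o = k * (a * b * c * d) := by
  obtain ⟨h1, h2, h3, h4⟩ := cubic_coeffs_eq_zero_s13 (k := l + k * (a + b + c + d))
    (l := m - k * (a * b + b * c + c * a + (a + b + c) * d))
    (m := n + k * (a * b * c + (a * b + b * c + c * a) * d))
    (n := o - k * (a * b * c * d)) hab hac had hbc hbd hcd
    (by linear_combination ha) (by linear_combination hb) (by linear_combination hc)
    (by linear_combination hd)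
  exact ⟨by linear_combination h1, by linear_combination h2, by linear_combination h3,
    by linear_combination h4⟩

lemma collinear_of_mul_conj {x y z : ℂ}
    (h : (x - z) * conj (y - z) = conj (x - z) * (y - z)) :
    Collinear ℝ ({x, y, z} : Set ℂ) := by
  by_cases hyz : y = z
  · subst hyz
    simpa using collinear_pair ℝ x y
  have hyz' : y - z ≠ 0 := sub_ne_zero.2 hyz
  have him : ((x - z) / (y - z)).im = 0 := by
    rw [← Complex.conj_eq_iff_im, map_div₀, div_eq_div_iff ((map_ne_zero _).2 hyz') hyz']
    exact h.symm
  have hre : ((((x - z) / (y - z)).re : ℝ) : ℂ) = (x - z) / (y - z) :=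
    Complex.ext (by simp) (by simp [him])
  rw [collinear_iff_of_mem (p₀ := z) (by simp)]
  refine ⟨y - z, ?_⟩
  rintro w (rfl | rfl | rfl)
  · refine ⟨((w - z) / (y - z)).re, ?_⟩
    rw [vadd_eq_add, Complex.real_smul, hre, div_mul_cancel₀ _ hyz', sub_add_cancel]
  · exact ⟨1, by simp⟩
  · exact ⟨0, by simp⟩

lemma conicEval_coeffs_eq_zero {a b c d e f : ℝ} (h : ∀ z, conicEval a b c d e f z = 0) :
    a = 0 ∧ b = 0 ∧ c = 0 ∧ d = 0 ∧ e = 0 ∧ f = 0 := by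
  have h0 := h ⟨0, 0⟩
  have h1 := h ⟨1, 0⟩
  have h2 := h ⟨-1, 0⟩
  have h3 := h ⟨0, 1⟩
  have h4 := h ⟨0, -1⟩
  have h5 := h ⟨1, 1⟩
  simp only [conicEval] at h0 h1 h2 h3 h4 h5
  refine ⟨?_, ?_, ?_, ?_, ?_, ?_⟩ <;> linarith

/-- The form of a real quadratic polynomial, and of its directional derivatives, in the
complex coordinate `w` with `z = O + r * w`. -/
lemma exists_complex_form (a b c d e f : ℝ) (O : ℂ) (r : ℝ) :
    ∃ α β κ γ : ℂ,
      (∀ w : ℂ, (conicEval a b c d e f (O + r * w) : ℂ) =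
        α * w ^ 2 + conj α * conj w ^ 2 + κ * (w * conj w) + β * w + conj β * conj w + γ) ∧
      ∀ w v : ℂ, (((r * v).re * (conicGrad a b c d e f (O + r * w)).re +
          (r * v).im * (conicGrad a b c d e f (O + r * w)).im : ℝ) : ℂ) =
        2 * α * w * v + 2 * conj α * conj w * conj v + κ * (w * conj v + conj w * v) +
          β * v + conj β * conj v := by
  set α₀ : ℂ := ⟨(a - c) / 4, -b / 4⟩ with hα
  set β₀ : ℂ := ⟨d / 2, -e / 2⟩ with hβ
  have key : ∀ z : ℂ, (conicEval a b c d e f z : ℂ) = α₀ * z ^ 2 + conj α₀ * conj z ^ 2 +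
      ((a + c) / 2 : ℝ) * (z * conj z) + β₀ * z + conj β₀ * conj z + f := by
    intro z
    apply Complex.ext
    · simp [hα, hβ, conicEval, pow_two]
      ring
    · simp [hα, hβ, conicEval, pow_two]
      ring
  have key' : ∀ z v : ℂ, ((v.re * (conicGrad a b c d e f z).re +
      v.im * (conicGrad a b c d e f z).im : ℝ) : ℂ) = 2 * α₀ * z * v +
      2 * conj α₀ * conj z * conj v + ((a + c) / 2 : ℝ) * (z * conj v + conj z * v) +
      β₀ * v + conj β₀ * conj v := by
    intro z v
    apply Complex.ext
    · simp [hα, hβ, conicGrad]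
      ring
    · simp [hα, hβ, conicGrad]
      ring
  refine ⟨r ^ 2 * α₀, r * (2 * α₀ * O + ((a + c) / 2 : ℝ) * conj O + β₀),
    r ^ 2 * ((a + c) / 2 : ℝ), conicEval a b c d e f O, fun w => ?_, fun w v => ?_⟩
  · rw [key, key]
    simp only [map_add, map_mul, map_pow, Complex.conj_ofReal, Complex.conj_conj, map_ofNat]
    ring
  · rw [key']
    simp only [map_add, map_mul, map_pow, Complex.conj_ofReal, Complex.conj_conj, map_ofNat]
    ring

/-- A conic through four points of a circle and a point off it belongs to the pencil spanned by
the circle and the conic with vanishing `w * conj w` coefficient. -/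
lemma exists_pencil_form {a b c d e f : ℝ}
    (h0 : ¬(a = 0 ∧ b = 0 ∧ c = 0 ∧ d = 0 ∧ e = 0 ∧ f = 0)) (O : ℂ) {r : ℝ} (hr : r ≠ 0)
    {x y z t p : ℂ} (hxy : x ≠ y) (hxz : x ≠ z) (hxt : x ≠ t) (hyz : y ≠ z) (hyt : y ≠ t)
    (hzt : z ≠ t) (hx : x * conj x = 1) (hy : y * conj y = 1) (hz : z * conj z = 1)
    (ht : t * conj t = 1) (hp : p * conj p ≠ 1)
    (hxS : conicEval a b c d e f (O + r * x) = 0) (hyS : conicEval a b c d e f (O + r * y) = 0)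
    (hzS : conicEval a b c d e f (O + r * z) = 0) (htS : conicEval a b c d e f (O + r * t) = 0)
    (hpS : conicEval a b c d e f (O + r * p) = 0) :
    ∃ α κ : ℂ, α ≠ 0 ∧
      (∀ w : ℂ, (conicEval a b c d e f (O + r * w) : ℂ) =
        α * (w ^ 2 - (x + y + z + t) * w + (x * y + y * z + z * x + (x + y + z) * t) -
          (x * y * z + (x * y + y * z + z * x) * t) * conj w +
          x * y * z * t * conj w ^ 2) + κ * (w * conj w - 1)) ∧
      ∀ w v : ℂ, (((r * v).re * (conicGrad a b c d e f (O + r * w)).re +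
          (r * v).im * (conicGrad a b c d e f (O + r * w)).im : ℝ) : ℂ) =
        α * (2 * w * v - (x + y + z + t) * v -
          (x * y * z + (x * y + y * z + z * x) * t) * conj v +
          2 * (x * y * z * t) * conj w * conj v) + κ * (w * conj v + conj w * v) := by
  obtain ⟨α, β, κ, γ, hE, hG⟩ := exists_complex_form a b c d e f O r
  have quartic : ∀ w : ℂ, w * conj w = 1 → conicEval a b c d e f (O + r * w) = 0 →
      α * w ^ 4 + β * w ^ 3 + (κ + γ) * w ^ 2 + conj β * w + conj α = 0 := by
    intro w hw h
    have := hE w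
    rw [h, Complex.ofReal_zero] at this
    linear_combination -w ^ 2 * this - (conj α * (w * conj w + 1) + κ * w ^ 2 +
      conj β * w) * hw
  obtain ⟨h1, h2, h3, h4⟩ := vieta_quartic hxy hxz hxt hyz hyt hzt (quartic x hx hxS)
    (quartic y hy hyS) (quartic z hz hzS) (quartic t ht htS)
  have hE' : ∀ w : ℂ, (conicEval a b c d e f (O + r * w) : ℂ) =
        α * (w ^ 2 - (x + y + z + t) * w + (x * y + y * z + z * x + (x + y + z) * t) -
          (x * y * z + (x * y + y * z + z * x) * t) * conj w +
          x * y * z * t * conj w ^ 2) + κ * (w * conj w - 1) := by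
    intro w
    rw [hE]
    linear_combination w * h1 + h2 + conj w * h3 + conj w ^ 2 * h4
  refine ⟨α, κ, ?_, hE', fun w v => ?_⟩
  · rintro rfl
    have hκ : κ = 0 := by
      have := hE' p
      rw [hpS, Complex.ofReal_zero] at this
      exact mul_right_cancel₀ (sub_ne_zero.2 hp) (by linear_combination -this)
    refine h0 (conicEval_coeffs_eq_zero fun u => ?_)
    have := hE' ((u - O) / r)
    rw [mul_div_cancel₀ _ (Complex.ofReal_ne_zero.2 hr), add_sub_cancel, hκ] at this
    exact_mod_cast (by simpa using this : (conicEval a b c d e f u : ℂ) = 0)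
  · rw [hG]
    linear_combination v * h1 + conj v * h3 + 2 * conj w * conj v * h4

/-- The point `t` is the second intersection of the unit circle with the line through
its point `e` and a point `p`. -/
lemma second_intersection_eq {e p t : ℂ} (he : e * conj e = 1) (ht : t * conj t = 1)
    (hte : t ≠ e) (h : t ∈ lineThrough e p) : t * (e * conj p - 1) = e - p := by
  obtain ⟨τ, hτ⟩ := h
  rw [Complex.real_smul] at hτ
  have hτ' := congrArg conj hτ
  simp only [map_add, map_mul, map_sub, Complex.conj_ofReal] at hτ'
  have hτ0 : (τ : ℂ) ≠ 0 := by
    intro h0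
    exact hte (by rw [hτ, h0]; ring)
  apply mul_left_cancel₀ hτ0
  linear_combination -t * e * hτ' - hτ + (τ * t - t) * he + e * ht

lemma mem_of_second_intersection_eq {e p t : ℂ} (he : e * conj e = 1) (hpe : p ≠ e)
    (h : t * (e * conj p - 1) = e - p) : t * conj t = 1 ∧ t ∈ lineThrough e p := by
  have he0 : e ≠ 0 := left_ne_zero_of_mul_eq_one he
  have hpe' : p - e ≠ 0 := sub_ne_zero.2 hpe
  have hcpe : conj p - conj e ≠ 0 := by
    rw [← map_sub]
    exact (map_ne_zero _).2 hpe'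
  have h' := congrArg conj h
  simp only [map_mul, map_sub, Complex.conj_conj, map_one] at h'
  constructor
  · apply mul_left_cancel₀ (mul_ne_zero hpe' hcpe)
    linear_combination conj t * (conj e * p - 1) * h + (e - p) * h' +
      t * conj t * (1 - p * conj p) * he
  · refine ⟨((2 - p * conj e - e * conj p) / ((p - e) * (conj p - conj e))).re, ?_⟩
    have hreal : ((((2 - p * conj e - e * conj p) / ((p - e) * (conj p - conj e))).re : ℝ) : ℂ) =
        (2 - p * conj e - e * conj p) / ((p - e) * (conj p - conj e)) := by
      rw [← Complex.conj_eq_iff_re]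
      simp only [map_div₀, map_mul, map_sub, Complex.conj_conj, map_ofNat]
      congr 1 <;> ring
    have hquot : (2 - p * conj e - e * conj p) / ((p - e) * (conj p - conj e)) * (p - e) =
        (2 - p * conj e - e * conj p) / (conj p - conj e) := by
      field_simp
    rw [Complex.real_smul, hreal, hquot, ← sub_eq_iff_eq_add', eq_div_iff hcpe]
    apply mul_left_cancel₀ he0
    linear_combination h + (-t + e + p) * he

lemma cross_ne_zero_of_not_collinear {x y z : ℂ} (h : ¬ Collinear ℝ ({x, y, z} : Set ℂ)) :
    (x.re - z.re) * (y.im - z.im) - (y.re - z.re) * (x.im - z.im) ≠ 0 := by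
  intro h0
  refine h (collinear_of_mul_conj (Complex.ext ?_ ?_))
  · simp
    ring
  · simp
    linarith

/-- A conic through four points, no three of them collinear, is nonsingular at each of them. -/
lemma conicGrad_ne_zero {a b c d e f : ℝ}
    (h0 : ¬(a = 0 ∧ b = 0 ∧ c = 0 ∧ d = 0 ∧ e = 0 ∧ f = 0)) {x y z p : ℂ}
    (hx : conicEval a b c d e f x = 0) (hy : conicEval a b c d e f y = 0)
    (hz : conicEval a b c d e f z = 0) (hp : conicEval a b c d e f p = 0)
    (hxy : ¬ Collinear ℝ ({x, y, p} : Set ℂ)) (hxz : ¬ Collinear ℝ ({x, z, p} : Set ℂ))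
    (hyz : ¬ Collinear ℝ ({y, z, p} : Set ℂ)) : conicGrad a b c d e f p ≠ 0 := by
  intro hg
  have g1 : 2 * a * p.re + b * p.im + d = 0 := by
    simpa [conicGrad] using congrArg Complex.re hg
  have g2 : b * p.re + 2 * c * p.im + e = 0 := by
    simpa [conicGrad] using congrArg Complex.im hg
  have quad : ∀ w : ℂ, conicEval a b c d e f w = 0 →
      a * (w.re - p.re) ^ 2 + b * (w.re - p.re) * (w.im - p.im) + c * (w.im - p.im) ^ 2 = 0 := by
    intro w hw
    simp only [conicEval] at hw hp
    linear_combination hw - hp - (w.re - p.re) * g1 - (w.im - p.im) * g2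
  have dxy := cross_ne_zero_of_not_collinear hxy
  have dxz := cross_ne_zero_of_not_collinear hxz
  have dyz := cross_ne_zero_of_not_collinear hyz
  have qx := quad x hx
  have qy := quad y hy
  have qz := quad z hz
  generalize x.re - p.re = x1, x.im - p.im = x2, y.re - p.re = y1, y.im - p.im = y2,
    z.re - p.re = z1, z.im - p.im = z2 at *
  have hdet := mul_ne_zero (mul_ne_zero dxy dxz) dyz
  have ha : a = 0 := mul_left_cancel₀ hdet (by
    linear_combination y2 * z2 * (y1 * z2 - z1 * y2) * qx - x2 * z2 * (x1 * z2 - z1 * x2) * qy +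
      x2 * y2 * (x1 * y2 - y1 * x2) * qz)
  have hb : b = 0 := mul_left_cancel₀ hdet (by
    linear_combination -(y1 * z2 + z1 * y2) * (y1 * z2 - z1 * y2) * qx +
      (x1 * z2 + z1 * x2) * (x1 * z2 - z1 * x2) * qy -
      (x1 * y2 + y1 * x2) * (x1 * y2 - y1 * x2) * qz)
  have hc : c = 0 := mul_left_cancel₀ hdet (by
    linear_combination y1 * z1 * (y1 * z2 - z1 * y2) * qx - x1 * z1 * (x1 * z2 - z1 * x2) * qy +
      x1 * y1 * (x1 * y2 - y1 * x2) * qz)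
  subst ha hb hc
  have hd : d = 0 := by linarith
  have he : e = 0 := by linarith
  subst hd he
  exact h0 ⟨rfl, rfl, rfl, rfl, rfl, by simpa [conicEval] using hp⟩

lemma lineThrough_eq_perpLineAt {p q g : ℂ} (hpq : p ≠ q) (hg : g ≠ 0)
    (h : (q - p).re * g.re + (q - p).im * g.im = 0) : lineThrough p q = perpLineAt p g := by
  have hv : (q - p).re ^ 2 + (q - p).im ^ 2 ≠ 0 := by
    have := Complex.normSq_pos.2 (sub_ne_zero.2 hpq.symm)
    rw [Complex.normSq_apply] at this
    nlinarith
  have hg' : g.re ^ 2 + g.im ^ 2 ≠ 0 := by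
    have := Complex.normSq_pos.2 hg
    rw [Complex.normSq_apply] at this
    nlinarith
  ext w
  constructor
  · rintro ⟨t, rfl⟩
    simp only [perpLineAt, Set.mem_ofPred_eq, add_sub_cancel_left, Complex.smul_re,
      Complex.smul_im, smul_eq_mul]
    linear_combination t * h
  · intro hw
    simp only [perpLineAt, Set.mem_ofPred_eq] at hw
    have hcross : (w - p).re * (q - p).im - (w - p).im * (q - p).re = 0 := by
      apply mul_left_cancel₀ hg'
      linear_combination (g.re * (q - p).im - g.im * (q - p).re) * hw -
        (g.re * (w - p).im - g.im * (w - p).re) * h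
    refine ⟨((w - p).re * (q - p).re + (w - p).im * (q - p).im) /
      ((q - p).re ^ 2 + (q - p).im ^ 2), ?_⟩
    rw [← sub_eq_iff_eq_add']
    apply Complex.ext
    · rw [Complex.smul_re, smul_eq_mul, div_mul_eq_mul_div, eq_div_iff hv]
      linear_combination (q - p).im * hcross
    · rw [Complex.smul_im, smul_eq_mul, div_mul_eq_mul_div, eq_div_iff hv]
      linear_combination -(q - p).re * hcross

/-- In coordinates where the circumcircle is the unit circle, each vertex is a root of a cubic
with coefficients determined by a pair of isogonal conjugates. -/
lemma cubic_of_isogonal {O a b c p q : ℂ} {r : ℝ} (hr : r ≠ 0) (hab : a ≠ b) (hac : a ≠ c)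
    (ha : a * conj a = 1) (hb : b * conj b = 1) (hc : c * conj c = 1)
    (h : ((O + r * p - (O + r * a)) * (O + r * q - (O + r * a)) /
      ((O + r * b - (O + r * a)) * (O + r * c - (O + r * a)))).im = 0) :
    a ^ 3 - (p + q + a * b * c * (conj p * conj q)) * a ^ 2 +
      (p * q + a * b * c * (conj p + conj q)) * a - a * b * c = 0 := by
  have hr' : (r : ℂ) ≠ 0 := Complex.ofReal_ne_zero.2 hr
  have hba : b - a ≠ 0 := sub_ne_zero.2 hab.symm
  have hca : c - a ≠ 0 := sub_ne_zero.2 hac.symm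
  have hsimp : (O + r * p - (O + r * a)) * (O + r * q - (O + r * a)) /
      ((O + r * b - (O + r * a)) * (O + r * c - (O + r * a))) =
      (p - a) * (q - a) / ((b - a) * (c - a)) := by
    have hx : ∀ x : ℂ, O + r * x - (O + r * a) = r * (x - a) := fun x => by ring
    simp only [hx]
    field_simp
  rw [hsimp, ← Complex.conj_eq_iff_im, map_div₀, div_eq_div_iff
    ((map_ne_zero _).2 (mul_ne_zero hba hca)) (mul_ne_zero hba hca)] at h
  simp only [map_mul, map_sub] at h
  have hb' : (conj b - conj a) * (a * b) = -(b - a) := by linear_combination a * hb - b * ha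
  have hc' : (conj c - conj a) * (a * c) = -(c - a) := by linear_combination a * hc - c * ha
  have hp' : (conj p - conj a) * a = a * conj p - 1 := by linear_combination -ha
  have hq' : (conj q - conj a) * a = a * conj q - 1 := by linear_combination -ha
  have key : b * c * ((a * conj p - 1) * (a * conj q - 1)) = (p - a) * (q - a) := by
    apply mul_right_cancel₀ (mul_ne_zero hba hca)
    rw [← hp', ← hq']
    calc _ = a * b * (a * c) * ((conj p - conj a) * (conj q - conj a) * ((b - a) * (c - a))) := by
          ring
      _ = (p - a) * (q - a) * (((conj b - conj a) * (a * b)) * ((conj c - conj a) * (a * c))) := by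
          rw [h]
          ring
      _ = _ := by
          rw [hb', hc']
          ring
  linear_combination -a * key

lemma not_mem_circle_of_isogonal {a b c p q : ℂ} (hpa : p ≠ a) (hpb : p ≠ b) (hpc : p ≠ c)
    (h1 : p + q + a * b * c * (conj p * conj q) = a + b + c)
    (h2 : p * q + a * b * c * (conj p + conj q) = a * b + b * c + c * a) :
    p * conj p ≠ 1 := by
  intro h
  have : (p - a) * (p - b) * (p - c) = 0 := by
    linear_combination p ^ 2 * h1 - p * h2 + a * b * c * (1 - p * conj q) * h
  simp [sub_eq_zero, hpa, hpb, hpc] at this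

/-- If the point `d` of the unit circle lies on the line `pq` of two isogonal conjugates, where
the direction of that line is isogonal to `d`, then this line passes through a vertex. -/
lemma vertex_mem_line {a b c p q d : ℂ} (ha : a * conj a = 1) (hb : b * conj b = 1)
    (hc : c * conj c = 1) (hd : d * conj d = 1)
    (h1 : p + q + a * b * c * (conj p * conj q) = a + b + c)
    (h2 : p * q + a * b * c * (conj p + conj q) = a * b + b * c + c * a)
    (hp : d * (d - p) = -(a * b * c) * (conj d - conj p))
    (hq : d * (d - q) = -(a * b * c) * (conj d - conj q)) :
    (a - q) * conj (p - q) = conj (a - q) * (p - q) ∨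
    (b - q) * conj (p - q) = conj (b - q) * (p - q) ∨
    (c - q) * conj (p - q) = conj (c - q) * (p - q) := by
  have hp' : d ^ 3 - p * d ^ 2 = -(a * b * c) + a * b * c * conj p * d := by
    linear_combination d * hp - a * b * c * hd
  have hq' : d ^ 3 - q * d ^ 2 = -(a * b * c) + a * b * c * conj q * d := by
    linear_combination d * hq - a * b * c * hd
  have hd0 : d ≠ 0 := left_ne_zero_of_mul_eq_one hd
  have aux : ∀ x y : ℂ, x * conj x = 1 → a * b * c = x * y → d ^ 2 = y →
      (x - q) * conj (p - q) = conj (x - q) * (p - q) := by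
    intro x y hx hs hy
    subst hy
    rw [hs] at hp' hq'
    have ep : d - p = -x + x * conj p * d :=
      mul_left_cancel₀ (pow_ne_zero 2 hd0) (by linear_combination hp')
    have eq : d - q = -x + x * conj q * d :=
      mul_left_cancel₀ (pow_ne_zero 2 hd0) (by linear_combination hq')
    simp only [map_sub]
    have hx0 : x ≠ 0 := left_ne_zero_of_mul_eq_one hx
    apply mul_left_cancel₀ (mul_ne_zero hx0 hd0)
    linear_combination (x - q) * (eq - ep) - (p - q) * eq - (p - q) * d * hx
  have hprod : (d ^ 2 - b * c) * (d ^ 2 - c * a) * (d ^ 2 - a * b) = 0 := by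
    linear_combination d ^ 4 * h2 - a * b * c * d ^ 2 * h1 - (a * b * c - q * d ^ 2) * hp' +
      (d ^ 3 - a * b * c * conj p * d) * hq'
  rcases mul_eq_zero.1 hprod with h | h
  · rcases mul_eq_zero.1 h with h | h
    · exact Or.inl (aux a _ ha (by ring) (sub_eq_zero.1 h))
    · exact Or.inr (Or.inl (aux b _ hb (by ring) (sub_eq_zero.1 h)))
  · exact Or.inr (Or.inr (aux c _ hc (by ring) (sub_eq_zero.1 h)))

lemma exists_eq_add_mul {r : ℝ} (hr : r ≠ 0) (O z : ℂ) : ∃ w : ℂ, z = O + r * w :=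
  ⟨(z - O) / r, by rw [mul_div_cancel₀ _ (Complex.ofReal_ne_zero.2 hr), add_sub_cancel]⟩

lemma add_mul_mem_circleSet {O w : ℂ} {r : ℝ} (hr : 0 < r) :
    O + r * w ∈ circleSet O r ↔ w * conj w = 1 := by
  rw [Complex.mul_conj, Complex.normSq_eq_norm_sq]
  simp only [circleSet, Set.mem_ofPred_eq, add_sub_cancel_left, norm_mul, Complex.norm_real,
    Real.norm_of_nonneg hr.le]
  rw [mul_eq_left₀ hr.ne']
  norm_cast
  exact (pow_eq_one_iff_of_nonneg (norm_nonneg w) two_ne_zero).symm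

lemma add_mul_mem_lineThrough {O u v w : ℂ} {r : ℝ} (hr : r ≠ 0) :
    O + r * w ∈ lineThrough (O + r * u) (O + r * v) ↔ w ∈ lineThrough u v := by
  have hr' : (r : ℂ) ≠ 0 := Complex.ofReal_ne_zero.2 hr
  refine exists_congr fun t => ⟨fun h => ?_, fun h => ?_⟩
  · rw [Complex.real_smul] at h ⊢
    exact mul_left_cancel₀ hr' (by linear_combination h)
  · rw [Complex.real_smul] at h ⊢
    linear_combination r * h

lemma mul_conj_ne_of_not_collinear {O x y z : ℂ} {r : ℝ}
    (h : ¬ Collinear ℝ ({O + r * x, O + r * y, O + r * z} : Set ℂ)) :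
    (x - z) * conj (y - z) ≠ conj (x - z) * (y - z) := by
  intro h0
  apply h
  apply collinear_of_mul_conj
  simp only [map_sub, map_add, map_mul, Complex.conj_ofReal] at h0 ⊢
  linear_combination r ^ 2 * h0

lemma pairwise_ne_of_not_collinear {x y z : ℂ} (h : ¬ Collinear ℝ ({x, y, z} : Set ℂ)) :
    x ≠ y ∧ x ≠ z ∧ y ≠ z := by
  refine ⟨?_, ?_, ?_⟩ <;> rintro rfl <;> apply h
  · simpa using collinear_pair ℝ x z
  · simpa [Set.pair_comm] using collinear_pair ℝ x y
  · simpa using collinear_pair ℝ x y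

/-- The position, in the pencil of conics through the vertices and a point `d` of the
circumcircle, of the conic through one of two isogonal conjugates `p`, `q`. -/
lemma pencil_parameter_eq {a b c d p q α κ : ℂ} (hp1 : p * conj p ≠ 1)
    (h1 : p + q + a * b * c * (conj p * conj q) = a + b + c)
    (h2 : p * q + a * b * c * (conj p + conj q) = a * b + b * c + c * a)
    (hp : 0 = α * (p ^ 2 - (a + b + c + d) * p + (a * b + b * c + c * a + (a + b + c) * d) -
      (a * b * c + (a * b + b * c + c * a) * d) * conj p +
      a * b * c * d * conj p ^ 2) + κ * (p * conj p - 1)) :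
    κ = α * (a * b * c * conj q + d * q) := by
  apply mul_left_cancel₀ (sub_ne_zero.2 hp1)
  linear_combination -hp + α * (d - p) * h1 + α * (1 - d * conj p) * h2

/-- The derivative at `p` in the direction `q - p` of the conic through the vertices, `e`
and `p`; the variables `p'`, `q'` stand for the complex conjugates of `p`, `q`. -/
lemma derivative_eq {a b c d e p q p' q' : ℂ}
    (h1 : p + q + a * b * c * (p' * q') = a + b + c)
    (h2 : p * q + a * b * c * (p' + q') = a * b + b * c + c * a)
    (hs : a * b * c = d ^ 2 * e) (hde : p - q = -(d * e) * (p' - q')) :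
    2 * p * (q - p) - (a + b + c + e) * (q - p) -
        (a * b * c + (a * b + b * c + c * a) * e) * (q' - p') +
        2 * (a * b * c * e) * p' * (q' - p') +
        (a * b * c * q' + e * q) * (p * (q' - p') + p' * (q - p)) =
      -(d * e) * (q' - p') *
        ((e - p) * (d * q' - 1) - (d - q) * (e * p' - 1)) := by
  obtain rfl : q = p + d * e * (p' - q') := by linear_combination -hde
  rw [← h1, ← h2, hs]
  ring

theorem statement13 (A B C O : ℂ) (r : ℝ) (Ω : Set ℂ)
    (hr : 0 < r) (hΩ : Ω = circleSet O r)
    (hAΩ : A ∈ Ω) (hBΩ : B ∈ Ω) (hCΩ : C ∈ Ω)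
    (hABC : ¬ Collinear ℝ ({A, B, C} : Set ℂ))
    (P P' : ℂ) (hPP : P ≠ P') (hconj : IsogConj A B C P P')
    (h5 : NoThreeCollinear [A, B, C, P, P'])
    (H : Set ℂ) (hH : IsConic H)
    (hAH : A ∈ H) (hBH : B ∈ H) (hCH : C ∈ H) (hPH : P ∈ H) (hPH2 : P' ∈ H)
    (D : ℂ) (hDΩ : D ∈ Ω) (hDH : D ∈ H) (hDA : D ≠ A) (hDB : D ≠ B) (hDC : D ≠ C)
    (D' : ℂ) (hD'D : D' ≠ D) (hD'Ω : D' ∈ Ω)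
    (hpar : ∃ t : ℝ, D' - D = t • (P' - P))
    (h5D' : NoThreeCollinear [A, B, C, D', P])
    (S : Set ℂ) (hS : IsConic S)
    (hAS : A ∈ S) (hBS : B ∈ S) (hCS : C ∈ S) (hD'S : D' ∈ S) (hPS : P ∈ S) :
    IsConicTangentLineAt S P (lineThrough P P') ↔
      ∃ T : ℂ, T ∈ Ω ∧ T ∈ lineThrough D' P ∧ T ∈ lineThrough D P' := by
  subst hΩ
  have hr' : (r : ℂ) ≠ 0 := Complex.ofReal_ne_zero.2 hr.ne'
  have h5 : ∀ i j k : Fin 5, i ≠ j → i ≠ k → j ≠ k → ¬ Collinear ℝ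
      ({[A, B, C, P, P'].get i, [A, B, C, P, P'].get j, [A, B, C, P, P'].get k} : Set ℂ) := h5
  have h5D' : ∀ i j k : Fin 5, i ≠ j → i ≠ k → j ≠ k → ¬ Collinear ℝ
      ({[A, B, C, D', P].get i, [A, B, C, D', P].get j, [A, B, C, D', P].get k} : Set ℂ) := h5D'
  have cAPP : ¬ Collinear ℝ ({A, P, P'} : Set ℂ) :=
    h5 0 3 4 (by decide) (by decide) (by decide)
  have cBPP : ¬ Collinear ℝ ({B, P, P'} : Set ℂ) :=
    h5 1 3 4 (by decide) (by decide) (by decide)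
  have cCPP : ¬ Collinear ℝ ({C, P, P'} : Set ℂ) :=
    h5 2 3 4 (by decide) (by decide) (by decide)
  have cABP : ¬ Collinear ℝ ({A, B, P} : Set ℂ) :=
    h5 0 1 3 (by decide) (by decide) (by decide)
  have cACP : ¬ Collinear ℝ ({A, C, P} : Set ℂ) :=
    h5 0 2 3 (by decide) (by decide) (by decide)
  have cBCP : ¬ Collinear ℝ ({B, C, P} : Set ℂ) :=
    h5 1 2 3 (by decide) (by decide) (by decide)
  have cABD : ¬ Collinear ℝ ({A, B, D'} : Set ℂ) :=
    h5D' 0 1 3 (by decide) (by decide) (by decide)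
  have cACD : ¬ Collinear ℝ ({A, C, D'} : Set ℂ) :=
    h5D' 0 2 3 (by decide) (by decide) (by decide)
  clear h5 h5D'
  obtain ⟨nAB, nAD', nBD'⟩ := pairwise_ne_of_not_collinear cABD
  obtain ⟨nAC, -, nCD'⟩ := pairwise_ne_of_not_collinear cACD
  obtain ⟨-, -, nBC⟩ := pairwise_ne_of_not_collinear hABC
  obtain ⟨nAP, nAP', -⟩ := pairwise_ne_of_not_collinear cAPP
  obtain ⟨nBP, nBP', -⟩ := pairwise_ne_of_not_collinear cBPP
  obtain ⟨nCP, nCP', -⟩ := pairwise_ne_of_not_collinear cCPP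
  -- Passage to coordinates in which the circle is the unit circle
  obtain ⟨a, rfl⟩ := exists_eq_add_mul hr.ne' O A
  obtain ⟨b, rfl⟩ := exists_eq_add_mul hr.ne' O B
  obtain ⟨c, rfl⟩ := exists_eq_add_mul hr.ne' O C
  obtain ⟨d, rfl⟩ := exists_eq_add_mul hr.ne' O D
  obtain ⟨e, rfl⟩ := exists_eq_add_mul hr.ne' O D'
  obtain ⟨p, rfl⟩ := exists_eq_add_mul hr.ne' O P
  obtain ⟨q, rfl⟩ := exists_eq_add_mul hr.ne' O P'
  rw [add_mul_mem_circleSet hr] at hAΩ hBΩ hCΩ hDΩ hD'Ω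
  simp only [ne_eq, add_right_inj, mul_right_inj' hr'] at *
  replace cAPP := mul_conj_ne_of_not_collinear cAPP
  replace cBPP := mul_conj_ne_of_not_collinear cBPP
  replace cCPP := mul_conj_ne_of_not_collinear cCPP
  -- The isogonality relations
  obtain ⟨iA, iB, iC⟩ := hconj
  have kA := cubic_of_isogonal hr.ne' nAB nAC hAΩ hBΩ hCΩ iA
  have kB := cubic_of_isogonal hr.ne' nBC (Ne.symm nAB) hBΩ hCΩ hAΩ iB
  have kC := cubic_of_isogonal hr.ne' (Ne.symm nAC) (Ne.symm nBC) hCΩ hAΩ hBΩ iC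
  obtain ⟨h1, h2⟩ := vieta_cubic nAB nAC nBC kA
    (show b ^ 3 - (p + q + a * b * c * (conj p * conj q)) * b ^ 2 +
      (p * q + a * b * c * (conj p + conj q)) * b - a * b * c = 0 by linear_combination kB)
    (by linear_combination kC)
  have hp1 : p * conj p ≠ 1 :=
    not_mem_circle_of_isogonal (Ne.symm nAP) (Ne.symm nBP) (Ne.symm nCP) h1 h2
  have hq1 : q * conj q ≠ 1 :=
    not_mem_circle_of_isogonal (q := p) (Ne.symm nAP') (Ne.symm nBP') (Ne.symm nCP')
      (by linear_combination h1) (by linear_combination h2)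
  have hpq : conj p - conj q ≠ 0 := by
    rw [← map_sub]
    exact (map_ne_zero _).2 (sub_ne_zero.2 hPP)
  -- The relations determining `d` and `e`
  have hd : d * (p - q) = -(a * b * c) * (conj p - conj q) := by
    obtain ⟨a₁, a₂, a₃, a₄, a₅, a₆, h0, rfl⟩ := hH
    obtain ⟨α, κ, hα, hE, -⟩ := exists_pencil_form h0 O hr.ne' nAB nAC (Ne.symm hDA) nBC
      (Ne.symm hDB) (Ne.symm hDC) hAΩ hBΩ hCΩ hDΩ hp1 hAH hBH hCH hDH hPH
    have eP := hE p
    have eQ := hE q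
    rw [show conicEval a₁ a₂ a₃ a₄ a₅ a₆ (O + r * p) = 0 from hPH, Complex.ofReal_zero] at eP
    rw [show conicEval a₁ a₂ a₃ a₄ a₅ a₆ (O + r * q) = 0 from hPH2, Complex.ofReal_zero] at eQ
    have kP := pencil_parameter_eq hp1 h1 h2 eP
    have kQ := pencil_parameter_eq (q := p) hq1 (by linear_combination h1)
      (by linear_combination h2) eQ
    apply mul_left_cancel₀ hα
    linear_combination kP - kQ
  have hde : p - q = -(d * e) * (conj p - conj q) := by
    obtain ⟨t, ht⟩ := hpar
    rw [Complex.real_smul] at ht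
    have ht' : e - d = t * (q - p) := mul_left_cancel₀ hr' (by linear_combination ht)
    have ht'' := congrArg conj ht'
    simp only [map_sub, map_mul, Complex.conj_ofReal] at ht''
    have ht0 : (t : ℂ) ≠ 0 := by
      intro h0
      rw [h0, zero_mul] at ht'
      exact hD'D (sub_eq_zero.1 ht')
    apply mul_left_cancel₀ ht0
    linear_combination ht' + e * hDΩ - d * hD'Ω + d * e * ht''
  have hs : a * b * c = d ^ 2 * e := by
    apply mul_right_cancel₀ hpq
    linear_combination hd - d * hde
  have hd0 : d ≠ 0 := left_ne_zero_of_mul_eq_one hDΩ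
  have he0 : e ≠ 0 := left_ne_zero_of_mul_eq_one hD'Ω
  have hT : (∃ T : ℂ, T ∈ circleSet O r ∧ T ∈ lineThrough (O + r * e) (O + r * p) ∧
      T ∈ lineThrough (O + r * d) (O + r * q)) ↔
      (e - p) * (d * conj q - 1) = (d - q) * (e * conj p - 1) := by
    have hne : d - q ≠ e * (d * conj q - 1) := by
      intro h
      rcases vertex_mem_line hAΩ hBΩ hCΩ hDΩ h1 h2
        (by linear_combination d * h - d * hde + d * e * hDΩ + (conj d - conj p) * hs)
        (by linear_combination d * h + d * e * hDΩ + (conj d - conj q) * hs) with h | h | h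
      · exact cAPP h
      · exact cBPP h
      · exact cCPP h
    constructor
    · rintro ⟨T, hTΩ, hTP, hTQ⟩
      obtain ⟨t, rfl⟩ := exists_eq_add_mul hr.ne' O T
      rw [add_mul_mem_circleSet hr] at hTΩ
      rw [add_mul_mem_lineThrough hr.ne'] at hTP hTQ
      have hte : t ≠ e := by
        rintro rfl
        exact hne (second_intersection_eq hDΩ hTΩ hD'D hTQ).symm
      have htd : t ≠ d := by
        rintro rfl
        have := second_intersection_eq hD'Ω hTΩ (Ne.symm hD'D) hTP
        exact hne (by linear_combination hde - this)
      have e1 := second_intersection_eq hD'Ω hTΩ hte hTP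
      have e2 := second_intersection_eq hDΩ hTΩ htd hTQ
      rw [← e1, ← e2]
      ring
    · intro h
      have hpe : p ≠ e := by
        rintro rfl
        exact hp1 hD'Ω
      have hqd : q ≠ d := by
        rintro rfl
        exact hq1 hDΩ
      have hpe' : e * conj p - 1 ≠ 0 := by
        intro h0
        have : conj p = conj e := mul_left_cancel₀ he0 (by linear_combination h0 - hD'Ω)
        exact hpe ((starRingEnd ℂ).injective this)
      obtain ⟨ht, htP⟩ := mem_of_second_intersection_eq hD'Ω hpe
        (div_mul_cancel₀ (e - p) hpe')
      obtain ⟨-, htQ⟩ := mem_of_second_intersection_eq (t := (e - p) / (e * conj p - 1)) hDΩ hqd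
        (by rw [div_mul_eq_mul_div, div_eq_iff hpe', h])
      exact ⟨_, (add_mul_mem_circleSet hr).2 ht, (add_mul_mem_lineThrough hr.ne').2 htP,
        (add_mul_mem_lineThrough hr.ne').2 htQ⟩
  rw [hT]
  -- The directional derivative of an equation of the conic
  have hgrad : ∀ a₁ a₂ a₃ a₄ a₅ a₆ : ℝ,
      ¬(a₁ = 0 ∧ a₂ = 0 ∧ a₃ = 0 ∧ a₄ = 0 ∧ a₅ = 0 ∧ a₆ = 0) →
      S = {z : ℂ | conicEval a₁ a₂ a₃ a₄ a₅ a₆ z = 0} →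
      ((O + r * q - (O + r * p)).re * (conicGrad a₁ a₂ a₃ a₄ a₅ a₆ (O + r * p)).re +
        (O + r * q - (O + r * p)).im * (conicGrad a₁ a₂ a₃ a₄ a₅ a₆ (O + r * p)).im = 0 ↔
      (e - p) * (d * conj q - 1) = (d - q) * (e * conj p - 1)) := by
    intro a₁ a₂ a₃ a₄ a₅ a₆ h0 hSeq
    subst hSeq
    obtain ⟨α, κ, hα, hE, hG⟩ := exists_pencil_form h0 O hr.ne' nAB nAC nAD' nBC
      nBD' nCD' hAΩ hBΩ hCΩ hD'Ω hp1 hAS hBS hCS hD'S hPS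
    have eP := hE p
    rw [show conicEval a₁ a₂ a₃ a₄ a₅ a₆ (O + r * p) = 0 from hPS, Complex.ofReal_zero] at eP
    have hκ := pencil_parameter_eq hp1 h1 h2 eP
    have hder := hG p (q - p)
    rw [hκ, map_sub, mul_assoc α, ← mul_add, derivative_eq h1 h2 hs hde] at hder
    rw [show O + r * q - (O + r * p) = r * (q - p) by ring, ← Complex.ofReal_eq_zero, hder,
      mul_eq_zero_iff_left hα, mul_eq_zero_iff_left, sub_eq_zero]
    exact mul_ne_zero (neg_ne_zero.2 (mul_ne_zero hd0 he0)) (by rwa [← neg_sub, neg_ne_zero])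
  constructor
  · rintro ⟨a₁, a₂, a₃, a₄, a₅, a₆, h0, hSeq, -, -, hL⟩
    rw [← hgrad a₁ a₂ a₃ a₄ a₅ a₆ h0 hSeq]
    have hmem : O + r * q ∈ lineThrough (O + r * p) (O + r * q) := ⟨1, by simp⟩
    rw [hL] at hmem
    exact hmem
  · intro h
    obtain ⟨a₁, a₂, a₃, a₄, a₅, a₆, h0, hSeq⟩ := hS
    have hg := (hgrad a₁ a₂ a₃ a₄ a₅ a₆ h0 hSeq).2 h
    have hg0 : conicGrad a₁ a₂ a₃ a₄ a₅ a₆ (O + r * p) ≠ 0 := by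
      rw [hSeq] at hAS hBS hCS hPS
      exact conicGrad_ne_zero h0 hAS hBS hCS hPS cABP cACP cBCP
    refine ⟨a₁, a₂, a₃, a₄, a₅, a₆, h0, hSeq, ?_, hg0, ?_⟩
    · rw [hSeq] at hPS
      exact hPS
    · exact lineThrough_eq_perpLineAt (by simpa [hr.ne'] using hPP) hg0 hg

end
end
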